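/- arXiv:1311.5726 — 3 statements merged into one kernel-verified Lean document; each statement's English description precedes it below -/
import Mathlib

section
/- There exist an absolute constant C > 0 and a threshold p_0 such that for every prime p > p_0 and every multiplicative subgroup Γ of F_p^* with −1 ∈ Γ and |Γ| ≥ C · p^{1/2} · (log p)^{1/3}, every nonzero element of F_p can be written as a sum of five elements of Γ, i.e. F_p^* ⊆ 5Γ := Γ+Γ+Γ+Γ+Γ. -/
open Finset

open Polynomial in
/-- The twisted derivation `Q ↦ X (X - 1) Q' + ℓ Q` on polynomials. -/
noncomputable def twistedDerivation {F : Type*} [Field F] (l : F[X]) : F[X] →ₗ[F] F[X] :=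
  LinearMap.mulLeft F (X * (X - 1)) ∘ₗ derivative + LinearMap.mulLeft F l

open Polynomial in
theorem twistedDerivation_apply {F : Type*} [Field F] (l Q : F[X]) :
    twistedDerivation l Q = X * (X - 1) * derivative Q + l * Q := by
  simp [twistedDerivation, mul_assoc]

open Polynomial in
theorem twistedDerivation_zero_pow_mul {F : Type*} [Field F] {l W : F[X]}
    (hW : twistedDerivation 0 W = l * W) (n : ℕ) (Q : F[X]) :
    (twistedDerivation 0 ^ n) (Q * W) = (twistedDerivation l ^ n) Q * W := by
  induction n generalizing Q with
  | zero => simp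
  | succ n ih =>
    rw [pow_succ, pow_succ, Module.End.mul_apply, Module.End.mul_apply, ← ih]
    congr 1
    simp only [twistedDerivation_apply, derivative_mul, zero_mul, add_zero] at hW ⊢
    linear_combination Q * hW

open Polynomial in
theorem twistedDerivation_zero_monomial {F : Type*} [Field F] (m k : ℕ) :
    twistedDerivation 0 (X ^ m * (X - 1) ^ k : F[X]) =
      ((m : F[X]) * (X - 1) + (k : F[X]) * X) * (X ^ m * (X - 1) ^ k) := by
  have h1 : (X : F[X]) * derivative (X ^ m : F[X]) = (m : F[X]) * X ^ m := by
    cases m with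
    | zero => simp
    | succ m => simp; ring
  have h2 : (X - 1 : F[X]) * derivative ((X - 1) ^ k : F[X]) = (k : F[X]) * (X - 1) ^ k := by
    cases k with
    | zero => simp
    | succ k => simp [derivative_pow]; ring
  rw [twistedDerivation_apply, derivative_mul]
  linear_combination ((X - 1) * (X - 1) ^ k) * h1 + (X * X ^ m) * h2

open Polynomial in
theorem twistedDerivation_pow_mem_degreeLT {F : Type*} [Field F] {l Q : F[X]} {A : ℕ}
    (hl : l.natDegree ≤ 1) (hQ : Q ∈ degreeLT F A) (n : ℕ) :
    (twistedDerivation l ^ n) Q ∈ degreeLT F (A + n) := by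
  induction n with
  | zero => simpa using hQ
  | succ n ih =>
    rw [pow_succ', Module.End.mul_apply]
    set R := (twistedDerivation l ^ n) Q
    by_cases hR : R = 0
    · simp [hR]
    rw [mem_degreeLT, ← natDegree_lt_iff_degree_lt hR] at ih
    rw [mem_degreeLT, twistedDerivation_apply]
    refine lt_of_le_of_lt (degree_le_of_natDegree_le (n := R.natDegree + 1) ?_) ?_
    · refine natDegree_add_le_of_degree_le ?_ ?_
      · by_cases h0 : R.natDegree = 0
        · rw [derivative_of_natDegree_zero h0]; simp
        · refine natDegree_mul_le.trans ?_
          have := natDegree_derivative_lt h0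
          have h2 : (X * (X - 1) : F[X]).natDegree ≤ 2 := by
            refine natDegree_mul_le.trans ?_
            have : (X - 1 : F[X]).natDegree ≤ 1 := by
              rw [← C_1]; exact (natDegree_X_sub_C _).le
            have := natDegree_X_le (R := F)
            omega
          omega
      · refine natDegree_mul_le.trans ?_
        omega
    · exact_mod_cast by omega

open Polynomial in
theorem X_sub_C_pow_dvd_of_twistedDerivation {p : ℕ} [Fact p.Prime] {P : (ZMod p)[X]}
    {u : ZMod p} (hu : u ≠ 0) (hu1 : u ≠ 1) {D : ℕ} (hD : D ≤ p)
    (h : ∀ n < D, ((twistedDerivation 0 ^ n) P).eval u = 0) : (X - C u) ^ D ∣ P := by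
  have key : ∀ (n k : ℕ) (R : (ZMod p)[X]), n ≤ k → ∃ S : (ZMod p)[X],
      (twistedDerivation 0 ^ n) ((X - C u) ^ k * R) = (X - C u) ^ (k - n) * S ∧
      S.eval u = (k.descFactorial n : ZMod p) * (u * (u - 1)) ^ n * R.eval u := by
    intro n
    induction n with
    | zero => intro k R _; exact ⟨R, by simp⟩
    | succ n ih =>
      intro k R hk
      obtain ⟨S, hS, hSe⟩ := ih k R (by omega)
      obtain ⟨m, hm⟩ : ∃ m, k - n = m + 1 := ⟨k - n - 1, by omega⟩
      refine ⟨(m + 1 : (ZMod p)[X]) * (X * (X - 1)) * S +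
        (X - C u) * (X * (X - 1)) * derivative S, ?_, ?_⟩
      · rw [pow_succ', Module.End.mul_apply, hS, hm, twistedDerivation_apply, derivative_mul,
          show k - (n + 1) = m by omega]
        simp [derivative_pow]
        ring
      · rw [Nat.descFactorial_succ, hm]
        simp [hSe]
        ring
  induction D with
  | zero => simp
  | succ D ih =>
    obtain ⟨R, hR⟩ := ih (by omega) fun n hn => h n (by omega)
    obtain ⟨S, hS, hSe⟩ := key D D R le_rfl
    have h0 := h D (by omega)
    rw [hR, hS, Nat.sub_self, pow_zero, one_mul, hSe, Nat.descFactorial_self] at h0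
    have hf : ((D.factorial : ℕ) : ZMod p) ≠ 0 := by
      rw [Ne, ZMod.natCast_eq_zero_iff, (Fact.out : p.Prime).dvd_factorial]
      omega
    have hR0 : R.eval u = 0 := by
      have := mul_ne_zero hf (pow_ne_zero D (mul_ne_zero hu (sub_ne_zero.2 hu1)))
      exact (mul_eq_zero.1 h0).resolve_left this
    obtain ⟨T, hT⟩ := dvd_iff_isRoot.2 hR0
    exact ⟨T, by rw [hR, hT]; ring⟩

open Polynomial in
/-- A sparse polynomial of degree below the characteristic cannot vanish to high order at `1`. -/
theorem eq_zero_of_X_sub_one_pow_dvd_of_card_support_le {p : ℕ} [Fact p.Prime] (r : ℕ)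
    (P : (ZMod p)[X]) (hr : P.support.card ≤ r) (hdeg : P.natDegree < p)
    (hdvd : (X - 1) ^ r ∣ P) : P = 0 := by
  induction r generalizing P with
  | zero => simpa using hr
  | succ r ih =>
    by_contra hP
    obtain ⟨m, hm⟩ := nonempty_support_iff.2 hP
    set Q := X * derivative P - C (m : ZMod p) * P with hQ
    have hcoeff : ∀ j, Q.coeff j = ((j : ZMod p) - m) * P.coeff j := by
      intro j
      rw [hQ, coeff_sub, coeff_C_mul]
      cases j with
      | zero => simp
      | succ j => rw [coeff_X_mul, coeff_derivative]; push_cast; ring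
    have hsupp : Q.support ⊆ P.support.erase m := by
      intro j hj
      rw [mem_support_iff, hcoeff] at hj
      refine mem_erase.2 ⟨?_, mem_support_iff.2 (right_ne_zero_of_mul hj)⟩
      rintro rfl
      simp at hj
    have hQ0 : Q = 0 := by
      refine ih Q ?_ ?_ ?_
      · have := card_le_card hsupp
        rw [card_erase_of_mem hm] at this
        omega
      · refine lt_of_le_of_lt (natDegree_le_natDegree ?_) hdeg
        exact degree_mono (hsupp.trans (erase_subset _ _))
      · obtain ⟨R, hR⟩ := hdvd
        refine dvd_sub (Dvd.dvd.mul_left ?_ _)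
          (Dvd.dvd.mul_left ((pow_dvd_pow _ r.le_succ).trans ⟨R, hR⟩) _)
        refine ⟨(r + 1 : (ZMod p)[X]) * R + (X - 1) * derivative R, ?_⟩
        rw [hR, derivative_mul]
        simp [derivative_pow]
        ring
    have hmono : P = monomial m (P.coeff m) := by
      ext j
      rw [coeff_monomial]
      split_ifs with h
      · rw [h]
      · by_contra hj
        have h1 := hcoeff j
        rw [hQ0, coeff_zero, eq_comm, mul_eq_zero, or_iff_left hj, sub_eq_zero,
          ZMod.natCast_eq_natCast_iff] at h1
        have hjp := (le_natDegree_of_ne_zero hj).trans_lt hdeg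
        have hmp := (le_natDegree_of_mem_supp m hm).trans_lt hdeg
        exact h (h1.eq_of_lt_of_lt hjp hmp).symm
    have h1 : P.eval 1 = 0 := by
      obtain ⟨R, hR⟩ := hdvd
      rw [hR]; simp
    rw [hmono, eval_monomial, one_pow, mul_one] at h1
    exact (mem_support_iff.1 hm) h1

open Polynomial in
theorem eq_zero_of_sum_monomial_mul_eq_zero {p : ℕ} [Fact p.Prime] {t A B : ℕ}
    (hAB : A * B ≤ t) (hdeg : A + t * B ≤ p) (v : Fin A × Fin B × Fin B → ZMod p)
    (h : ∑ c : Fin B, (∑ x : Fin A × Fin B, monomial (x.1 + t * x.2 : ℕ) (v (x.1, x.2, c))) *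
      (X - 1 : (ZMod p)[X]) ^ (t * c : ℕ) = 0) : v = 0 := by
  set Q : Fin B → (ZMod p)[X] :=
    fun c => ∑ x : Fin A × Fin B, monomial (x.1 + t * x.2 : ℕ) (v (x.1, x.2, c)) with hQ
  have hX : (X - 1 : (ZMod p)[X]) ≠ 0 := by rw [← C_1]; exact X_sub_C_ne_zero 1
  have hzero : ∀ c, Q c = 0 := by
    intro c
    induction hn : (c : ℕ) using Nat.strong_induction_on generalizing c with
    | _ n ih =>
      subst hn
      refine eq_zero_of_X_sub_one_pow_dvd_of_card_support_le t (Q c) ?_ ?_ ?_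
      · refine (card_le_card (t := univ.image fun x : Fin A × Fin B => (x.1 + t * x.2 : ℕ))
          fun j hj => ?_).trans (card_image_le.trans (by simpa using hAB))
        by_contra hj'
        refine mem_support_iff.1 hj ?_
        rw [hQ, finsetSum_coeff]
        refine sum_eq_zero fun x _ => coeff_monomial_of_ne _ ?_
        rintro rfl
        exact hj' (mem_image_of_mem _ (mem_univ x))
      · refine lt_of_le_of_lt (natDegree_sum_le_of_forall_le _ _ (n := p - 1) fun x _ => ?_)
          (Nat.sub_lt (Fact.out : p.Prime).pos one_pos)
        refine (natDegree_monomial_le _).trans ?_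
        have h1 := x.1.2
        have h2 : t * x.2 ≤ t * B := Nat.mul_le_mul_left _ x.2.2.le
        omega
      · have h1 : (X - 1 : (ZMod p)[X]) ^ (t * c + t) ∣ Q c * (X - 1) ^ (t * c : ℕ) := by
          rw [← add_sum_erase _ _ (mem_univ c), add_eq_zero_iff_eq_neg] at h
          rw [h, dvd_neg]
          refine dvd_sum fun d hd => ?_
          rcases lt_or_gt_of_ne (ne_of_mem_erase hd) with hlt | hgt
          · change _ ∣ Q d * _
            rw [ih d hlt d rfl, zero_mul]
            exact dvd_zero _
          · refine Dvd.dvd.mul_left (pow_dvd_pow _ ?_) _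
            calc t * c + t = t * (c + 1) := by ring
              _ ≤ t * d := Nat.mul_le_mul_left _ hgt
        rw [pow_add, mul_comm (Q c)] at h1
        exact (mul_dvd_mul_iff_left (pow_ne_zero _ hX)).1 h1
  funext ⟨a, b, c⟩
  have h1 : (Q c).coeff (a + t * b) = v (a, b, c) := by
    rw [hQ, finsetSum_coeff, sum_eq_single (a, b)]
    · simp
    · rintro ⟨a', b'⟩ _ hne
      refine coeff_monomial_of_ne _ fun heq => hne ?_
      have hAt : A ≤ t := (Nat.le_mul_of_pos_right A b.pos).trans hAB
      change (a + t * b : ℕ) = a' + t * b' at heq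
      have hm := congrArg (· % t) heq
      simp only [Nat.add_mul_mod_self_left, Nat.mod_eq_of_lt (a.2.trans_le hAt),
        Nat.mod_eq_of_lt (a'.2.trans_le hAt)] at hm
      have ht : 0 < t := a.pos.trans_le hAt
      have hb : (b : ℕ) = b' := Nat.eq_of_mul_eq_mul_left ht (by omega)
      exact Prod.ext (Fin.ext hm.symm) (Fin.ext hb.symm)
    · simp
  rw [← h1, hzero c, coeff_zero, Pi.zero_apply]

open Polynomial in
/-- The multiplicity-`A` auxiliary polynomial bound for `u ^ t = (u - 1) ^ t ∈ C`. -/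
theorem card_filter_pow_eq_pow_mul_le {p : ℕ} [Fact p.Prime] {t A B : ℕ} {C : Finset (ZMod p)}
    (hC : (0 : ZMod p) ∉ C) (ht : 0 < t) (hA : 0 < A) (hAB : A * B ≤ t) (hdeg : A + t * B ≤ p)
    (hdim : 2 * C.card * A < B ^ 2) :
    (univ.filter fun u : ZMod p => u ^ t ∈ C ∧ (u - 1) ^ t = u ^ t).card * A ≤
      A + 2 * t * B := by
  classical
  set blk : Fin B → Fin B → (Fin A × Fin B × Fin B → ZMod p) →ₗ[ZMod p] (ZMod p)[X] :=
    fun b c => ∑ a : Fin A, monomial (a : ℕ) ∘ₗ LinearMap.proj (a, b, c) with hblk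
  set l : Fin B → Fin B → (ZMod p)[X] := fun b c =>
    ((t * b : ℕ) : (ZMod p)[X]) * (X - 1) + ((t * c : ℕ) : (ZMod p)[X]) * X with hl
  have hl1 : ∀ b c, (l b c).natDegree ≤ 1 := by
    intro b c
    have h1 : (X - 1 : (ZMod p)[X]).natDegree ≤ 1 := by
      rw [← C_1]; exact (natDegree_X_sub_C _).le
    refine natDegree_add_le_of_degree_le ?_ ?_
    · exact natDegree_mul_le.trans (by rw [natDegree_natCast]; omega)
    · exact natDegree_mul_le.trans (by rw [natDegree_natCast, natDegree_X])
  set R : ZMod p → ℕ → (Fin A × Fin B × Fin B → ZMod p) →ₗ[ZMod p] (ZMod p)[X] :=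
    fun z n => ∑ b : Fin B, ∑ c : Fin B,
      z ^ (b + c : ℕ) • ((twistedDerivation (l b c) ^ n) ∘ₗ blk b c) with hR
  set L : (Fin A × Fin B × Fin B → ZMod p) →ₗ[ZMod p] (C × Fin A × Fin (2 * A) → ZMod p) :=
    LinearMap.pi fun x => lcoeff (ZMod p) (x.2.2 : ℕ) ∘ₗ R x.1 x.2.1 with hL
  obtain ⟨v, hv, hv0⟩ : ∃ v, L v = 0 ∧ v ≠ 0 := by
    have : LinearMap.ker L ≠ ⊥ := by
      refine LinearMap.ker_ne_bot_of_finrank_lt ?_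
      simp only [Module.finrank_fintype_fun_eq_card, Fintype.card_prod, Fintype.card_fin,
        Fintype.card_coe]
      nlinarith
    obtain ⟨v, hv, hv0⟩ := Submodule.exists_mem_ne_zero_of_ne_bot this
    exact ⟨v, hv, hv0⟩
  have hblk_mem : ∀ b c, blk b c v ∈ degreeLT (ZMod p) A := by
    intro b c
    simp only [hblk, LinearMap.sum_apply, LinearMap.comp_apply]
    refine Submodule.sum_mem _ fun a _ => mem_degreeLT.2 ?_
    exact (degree_monomial_le _ _).trans_lt (by exact_mod_cast a.2)
  have hRzero : ∀ z ∈ C, ∀ n < A, R z n v = 0 := by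
    intro z hz n hn
    have hmem : R z n v ∈ degreeLT (ZMod p) (2 * A) := by
      simp only [hR, LinearMap.sum_apply, LinearMap.smul_apply, LinearMap.comp_apply]
      refine Submodule.sum_mem _ fun b _ => Submodule.sum_mem _ fun c _ =>
        Submodule.smul_mem _ _ ?_
      exact degreeLT_mono (by omega)
        (twistedDerivation_pow_mem_degreeLT (hl1 b c) (hblk_mem b c) n)
    ext k
    rw [coeff_zero]
    by_cases hk : k < 2 * A
    · exact congrFun hv (⟨z, hz⟩, ⟨n, hn⟩, ⟨k, hk⟩)
    · refine coeff_eq_zero_of_degree_lt ((mem_degreeLT.1 hmem).trans_le ?_)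
      exact_mod_cast not_lt.1 hk
  set P : (ZMod p)[X] :=
    ∑ b : Fin B, ∑ c : Fin B, blk b c v * (X ^ (t * b : ℕ) * (X - 1) ^ (t * c : ℕ)) with hP
  have hP0 : P ≠ 0 := by
    intro hP0
    refine hv0 (eq_zero_of_sum_monomial_mul_eq_zero hAB hdeg v ?_)
    rw [← hP0, hP, sum_comm]
    refine sum_congr rfl fun c _ => ?_
    simp only [← mul_assoc, ← sum_mul]
    congr 1
    rw [Fintype.sum_prod_type_right]
    refine sum_congr rfl fun b _ => ?_
    simp only [hblk, LinearMap.sum_apply, LinearMap.comp_apply, sum_mul, LinearMap.proj_apply,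
      monomial_mul_X_pow]
  have hdvd : ∀ u : ZMod p, u ^ t ∈ C → (u - 1) ^ t = u ^ t → (X - Polynomial.C u) ^ A ∣ P := by
    intro u hu hu1
    refine X_sub_C_pow_dvd_of_twistedDerivation ?_ ?_ (by omega) fun n hn => ?_
    · rintro rfl
      rw [zero_pow ht.ne'] at hu
      exact hC hu
    · rintro rfl
      rw [sub_self, zero_pow ht.ne'] at hu1
      exact hC (hu1 ▸ hu)
    · have h1 := congrArg (Polynomial.eval u) (hRzero _ hu n hn)
      simp only [hR, LinearMap.sum_apply, LinearMap.smul_apply, LinearMap.comp_apply,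
        eval_finsetSum, eval_smul, eval_zero] at h1
      rw [← h1, hP]
      simp only [map_sum, eval_finsetSum]
      refine sum_congr rfl fun b _ => sum_congr rfl fun c _ => ?_
      rw [twistedDerivation_zero_pow_mul (l := l b c) (twistedDerivation_zero_monomial _ _)]
      simp only [eval_mul, eval_pow, eval_X, eval_sub, eval_one, pow_mul, hu1, smul_eq_mul,
        pow_add]
      ring
  set U := univ.filter fun u : ZMod p => u ^ t ∈ C ∧ (u - 1) ^ t = u ^ t with hU
  have hprod : ∏ u ∈ U, (X - Polynomial.C u) ^ A ∣ P := by
    refine prod_dvd_of_coprime (fun u _ w _ huw => ?_) fun u hu => ?_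
    · exact (isCoprime_X_sub_C_of_isUnit_sub (sub_ne_zero.2 huw).isUnit).pow
    · exact hdvd u (mem_filter.1 hu).2.1 (mem_filter.1 hu).2.2
  have hle := natDegree_le_of_dvd hprod hP0
  rw [natDegree_prod _ _ fun u _ => pow_ne_zero _ (X_sub_C_ne_zero u)] at hle
  simp only [natDegree_pow, natDegree_X_sub_C, mul_one, sum_const, smul_eq_mul] at hle
  refine hle.trans ?_
  refine natDegree_sum_le_of_forall_le _ _ fun b _ => natDegree_sum_le_of_forall_le _ _
    fun c _ => ?_
  have h1 : (X - 1 : (ZMod p)[X]).natDegree = 1 := by rw [← C_1]; exact natDegree_X_sub_C _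
  have h2 : (blk b c v).natDegree ≤ A := by
    refine natDegree_le_of_degree_le ?_
    exact (mem_degreeLT.1 (hblk_mem b c)).le
  have h3 : t * (b : ℕ) ≤ t * B := Nat.mul_le_mul_left _ b.2.le
  have h4 : t * (c : ℕ) ≤ t * B := Nat.mul_le_mul_left _ c.2.le
  refine natDegree_mul_le.trans ?_
  have h5 : (X ^ (t * b : ℕ) * (X - 1) ^ (t * c : ℕ) : (ZMod p)[X]).natDegree ≤
      t * b + t * c := by
    refine natDegree_mul_le.trans ?_
    rw [natDegree_X_pow, natDegree_pow, h1, mul_one]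
  rw [mul_assoc, two_mul]
  omega

theorem pred_card_filter_pow_eq_pow_cube_le {p : ℕ} [Fact p.Prime] {t : ℕ} {C : Finset (ZMod p)}
    (hC : (0 : ZMod p) ∉ C) (hC1 : 1 ≤ C.card) (ht : 8 * C.card ≤ t ^ 2)
    (htp : 2 * t ≤ p) (hp : 512 * C.card * t ^ 4 ≤ p ^ 3) :
    ((univ.filter fun u : ZMod p => u ^ t ∈ C ∧ (u - 1) ^ t = u ^ t).card - 1) ^ 3 ≤
      32 ^ 3 * t ^ 2 * C.card ^ 2 := by
  set J := C.card
  set N := (univ.filter fun u : ZMod p => u ^ t ∈ C ∧ (u - 1) ^ t = u ^ t).card with hN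
  set A := Nat.findGreatest (fun A => 8 * J * A ^ 3 ≤ t ^ 2) t with hAdef
  have ht0 : 0 < t := Nat.pos_of_ne_zero (by rintro rfl; omega)
  have hA1 : 1 ≤ A := Nat.le_findGreatest ht0 (by simpa using ht)
  have hAt : A ≤ t := Nat.findGreatest_le t
  have hA : 8 * J * A ^ 3 ≤ t ^ 2 :=
    Nat.findGreatest_spec (P := fun A => 8 * J * A ^ 3 ≤ t ^ 2) ht0 (by simpa using ht)
  have hA' : t ^ 2 < 64 * J * A ^ 3 := by
    have h1 : t ^ 2 < 8 * J * (A + 1) ^ 3 := by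
      rcases hAt.lt_or_eq with h | h
      · by_contra! hcon
        exact absurd (Nat.le_findGreatest (P := fun A => 8 * J * A ^ 3 ≤ t ^ 2) h hcon)
          (by omega)
      · rw [h]
        have : t ^ 2 ≤ (t + 1) ^ 3 := by nlinarith
        have : 0 < (t + 1) ^ 3 := by positivity
        nlinarith
    have h2 : (A + 1) ^ 3 ≤ (2 * A) ^ 3 := Nat.pow_le_pow_left (by omega) 3
    calc t ^ 2 < 8 * J * (A + 1) ^ 3 := h1
      _ ≤ 8 * J * (2 * A) ^ 3 := Nat.mul_le_mul_left _ h2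
      _ = 64 * J * A ^ 3 := by ring
  set B := t / A with hB
  have hAB : A * B ≤ t := Nat.mul_div_le t A
  have hB1 : 1 ≤ B := (Nat.one_le_div_iff (by omega)).2 hAt
  have hAB' : t < 2 * (A * B) := by
    have := Nat.lt_mul_div_succ t (show 0 < A by omega)
    rw [← hB] at this
    nlinarith
  have hdim : 2 * J * A < B ^ 2 := by
    have h1 : t ^ 2 < (2 * (A * B)) ^ 2 := Nat.pow_lt_pow_left hAB' (by norm_num)
    refine lt_of_mul_lt_mul_left (a := 4 * A ^ 2) ?_ (Nat.zero_le _)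
    nlinarith
  have hdeg : A + t * B ≤ p := by
    have h1 : 2 * (t * B) ≤ p := by
      refine le_of_pow_le_pow_left₀ (n := 3) (by norm_num) (Nat.zero_le _) ?_
      have h2 : (A * (t * B)) ^ 3 ≤ (t ^ 2) ^ 3 := Nat.pow_le_pow_left (by nlinarith) 3
      have h3 : t ^ 2 * t ^ 4 ≤ 64 * J * A ^ 3 * t ^ 4 := Nat.mul_le_mul_right _ hA'.le
      have h4 : A ^ 3 * (t * B) ^ 3 ≤ A ^ 3 * (64 * J * t ^ 4) := by nlinarith
      have h5 := le_of_mul_le_mul_left h4 (by positivity)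
      nlinarith
    omega
  have hmain := card_filter_pow_eq_pow_mul_le hC ht0 hA1 hAB hdeg hdim
  rw [← hN] at hmain
  have h1 : (N - 1) * A ^ 2 ≤ 2 * t ^ 2 := by
    have h2 : (N - 1) * A ≤ 2 * t * B := by
      rw [Nat.sub_mul, one_mul]; omega
    nlinarith
  have h2 : (N - 1) ^ 3 * A ^ 6 ≤ 8 * t ^ 6 := by
    have := Nat.pow_le_pow_left h1 3
    nlinarith
  have h3 : t ^ 4 ≤ 64 ^ 2 * J ^ 2 * A ^ 6 := by
    have := Nat.pow_le_pow_left hA'.le 2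
    nlinarith
  refine le_of_mul_le_mul_right (a := t ^ 4) ?_ (by positivity)
  calc (N - 1) ^ 3 * t ^ 4 ≤ (N - 1) ^ 3 * (64 ^ 2 * J ^ 2 * A ^ 6) := Nat.mul_le_mul_left _ h3
    _ = 64 ^ 2 * J ^ 2 * ((N - 1) ^ 3 * A ^ 6) := by ring
    _ ≤ 64 ^ 2 * J ^ 2 * (8 * t ^ 6) := Nat.mul_le_mul_left _ h2
    _ = 32 ^ 3 * t ^ 2 * J ^ 2 * t ^ 4 := by ring

theorem cube_mul_card_le_of_le_card {p : ℕ} [Fact p.Prime] {t m : ℕ} {C : Finset (ZMod p)}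
    (hC : (0 : ZMod p) ∉ C) (htp : t ^ 3 ≤ p ^ 2) (htp2 : 2 * t ≤ p)
    (hq : 512 ^ 2 * C.card ^ 2 ≤ t) (hm : 2 ≤ m)
    (h : ∀ z ∈ C, m ≤ (univ.filter fun u : ZMod p => u ^ t = z ∧ (u - 1) ^ t = z).card) :
    m ^ 3 * C.card ≤ 2 ^ 18 * t ^ 2 := by
  rcases Nat.eq_zero_or_pos C.card with h0 | hpos
  · simp [h0]
  set J := C.card with hJ
  set N := (univ.filter fun u : ZMod p => u ^ t ∈ C ∧ (u - 1) ^ t = u ^ t).card with hN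
  have hle : m * J ≤ N := by
    have h1 := card_eq_sum_card_fiberwise (f := fun u : ZMod p => u ^ t)
      (s := univ.filter fun u : ZMod p => u ^ t ∈ C ∧ (u - 1) ^ t = u ^ t) (t := C)
      fun u hu => by simpa using (mem_filter.1 hu).2.1
    rw [← hN] at h1
    rw [h1, mul_comm, hJ, ← smul_eq_mul, ← sum_const]
    refine sum_le_sum fun z hz => (h z hz).trans (card_le_card fun u hu => ?_)
    simp only [mem_filter, mem_univ, true_and] at hu ⊢
    exact ⟨⟨hu.1 ▸ hz, hu.2.trans hu.1.symm⟩, hu.1⟩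
  have hbound := pred_card_filter_pow_eq_pow_cube_le hC hpos (t := t) ?_ htp2 ?_
  · rw [← hN, ← hJ] at hbound
    have h1 : m * J ≤ 2 * (N - 1) := by
      have : 2 * 1 ≤ m * J := Nat.mul_le_mul hm hpos
      omega
    have h2 := Nat.pow_le_pow_left h1 3
    refine le_of_mul_le_mul_right (a := J ^ 2) ?_ (by positivity)
    nlinarith
  · have h1 : J ≤ J ^ 2 := Nat.le_self_pow two_ne_zero J
    have h2 : t ≤ t ^ 2 := Nat.le_self_pow two_ne_zero t
    omega
  · refine le_of_pow_le_pow_left₀ (n := 2) (by norm_num) (Nat.zero_le _) ?_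
    calc (512 * J * t ^ 4) ^ 2 = (512 ^ 2 * J ^ 2) * t ^ 8 := by ring
      _ ≤ t * t ^ 8 := Nat.mul_le_mul_right _ hq
      _ = (t ^ 3) ^ 3 := by ring
      _ ≤ (p ^ 2) ^ 3 := Nat.pow_le_pow_left htp 3
      _ = (p ^ 3) ^ 2 := by ring

/-- The number of representations of `s` as a difference of two elements of `G`. -/
def diffCount {p : ℕ} (G : Finset (ZMod p)) (s : ZMod p) : ℕ :=
  (G.filter fun x => x + s ∈ G).card

theorem sum_diffCount {p : ℕ} [Fact p.Prime] (G : Finset (ZMod p)) :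
    ∑ s, diffCount G s = G.card ^ 2 := by
  have h : ∀ s, diffCount G s = ∑ x ∈ G, if x + s ∈ G then 1 else 0 := fun s => by
    rw [diffCount, card_filter]
  simp_rw [h]
  rw [sum_comm, sq, ← smul_eq_mul, ← sum_const]
  refine sum_congr rfl fun x _ => ?_
  rw [Fintype.sum_equiv (Equiv.addLeft x) (fun s => if x + s ∈ G then 1 else 0)
    (fun y => if y ∈ G then 1 else 0) fun _ => rfl]
  simp

theorem mem_iff_pow_card_eq_one {p : ℕ} [Fact p.Prime] {G : Finset (ZMod p)}
    (h0 : (0 : ZMod p) ∉ G) (h1 : (1 : ZMod p) ∈ G) (hmul : ∀ x ∈ G, ∀ y ∈ G, x * y ∈ G)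
    (x : ZMod p) : x ∈ G ↔ x ^ G.card = 1 := by
  have hpos : 0 < G.card := card_pos.2 ⟨1, h1⟩
  have hpow : ∀ x ∈ G, x ^ G.card = 1 := by
    intro x hx
    have hx0 : x ≠ 0 := fun h => h0 (h ▸ hx)
    have himg : G.image (x * ·) = G :=
      eq_of_subset_of_card_le (image_subset_iff.2 fun y hy => hmul x hx y hy)
        (card_image_of_injective _ (mul_right_injective₀ hx0)).ge
    have hprod : ∏ y ∈ G, x * y = ∏ y ∈ G, y := by
      conv_rhs => rw [← himg]
      rw [prod_image fun a _ b _ h => mul_right_injective₀ hx0 h]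
    rw [prod_mul_distrib, prod_const] at hprod
    exact (mul_eq_right₀ (prod_ne_zero_iff.2 fun y hy h => h0 (h ▸ hy))).1 hprod
  refine ⟨hpow x, fun hx => ?_⟩
  have hsub : G ⊆ Polynomial.nthRootsFinset G.card (1 : ZMod p) :=
    fun y hy => (Polynomial.mem_nthRootsFinset hpos _).2 (hpow y hy)
  have hcard : (Polynomial.nthRootsFinset G.card (1 : ZMod p)).card ≤ G.card := by
    rw [Polynomial.nthRootsFinset_def]
    exact (Multiset.toFinset_card_le _).trans (Polynomial.card_nthRoots _ _)
  rw [eq_of_subset_of_card_le hsub hcard]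
  exact (Polynomial.mem_nthRootsFinset hpos _).2 hx

theorem cube_mul_card_le_diffCount_le {p : ℕ} [Fact p.Prime] {G : Finset (ZMod p)}
    (h0 : (0 : ZMod p) ∉ G) (h1 : (1 : ZMod p) ∈ G) (hmul : ∀ x ∈ G, ∀ y ∈ G, x * y ∈ G)
    (ht : 512 ^ 2 ≤ G.card) (htp : G.card ^ 3 ≤ p ^ 2) (htp2 : 2 * G.card ≤ p) (m : ℕ) :
    m ^ 3 * (univ.filter fun s : ZMod p => s ≠ 0 ∧ m ≤ diffCount G s).card ≤
      2 ^ 19 * G.card ^ 3 := by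
  classical
  set S := univ.filter fun s : ZMod p => s ≠ 0 ∧ m ≤ diffCount G s with hS
  set t := G.card with htdef
  have hpos : 0 < t := by omega
  have hmark : m * S.card ≤ t ^ 2 := by
    rw [← sum_diffCount, mul_comm, ← smul_eq_mul, ← sum_const]
    exact (sum_le_sum fun s hs => (mem_filter.1 hs).2.2).trans
      (sum_le_sum_of_subset (subset_univ S))
  rcases Nat.lt_or_ge m 2 with hm | hm
  · have : m ^ 2 ≤ 1 := by nlinarith
    calc m ^ 3 * S.card = m ^ 2 * (m * S.card) := by ring
      _ ≤ 1 * t ^ 2 := Nat.mul_le_mul this hmark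
      _ ≤ 2 ^ 19 * t ^ 3 := by
        have : t ^ 2 ≤ t ^ 3 := Nat.pow_le_pow_right hpos (by norm_num)
        omega
  set f : ZMod p → ZMod p := fun s => (-s⁻¹) ^ t with hf
  have hcount : ∀ s ∈ S,
      m ≤ (univ.filter fun u : ZMod p => u ^ t = f s ∧ (u - 1) ^ t = f s).card := by
    intro s hs
    obtain ⟨hs0, hsm⟩ := (mem_filter.1 hs).2
    refine hsm.trans (card_le_card_of_injOn (fun x => x * (-s⁻¹)) ?_ ?_)
    · intro x hx
      obtain ⟨hx, hxs⟩ := mem_filter.1 hx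
      rw [mem_iff_pow_card_eq_one h0 h1 hmul] at hx hxs
      rw [← htdef] at hx hxs
      simp only [coe_filter, mem_univ, true_and, Set.mem_ofPred_eq, hf]
      refine ⟨by rw [mul_pow, hx, one_mul], ?_⟩
      rw [show x * -s⁻¹ - 1 = (x + s) * -s⁻¹ by field_simp; ring, mul_pow, hxs, one_mul]
    · intro x _ y _ hxy
      exact mul_left_injective₀ (neg_ne_zero.2 (inv_ne_zero hs0)) hxy
  set C := S.image f with hC
  have hC0 : (0 : ZMod p) ∉ C := by
    intro h
    obtain ⟨s, hs, hs'⟩ := mem_image.1 h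
    exact pow_ne_zero t (neg_ne_zero.2 (inv_ne_zero (mem_filter.1 hs).2.1)) hs'
  have hcountC : ∀ z ∈ C,
      m ≤ (univ.filter fun u : ZMod p => u ^ t = z ∧ (u - 1) ^ t = z).card := by
    intro z hz
    obtain ⟨s, hs, rfl⟩ := mem_image.1 hz
    exact hcount s hs
  have hSC : S.card ≤ t * C.card := by
    refine card_le_mul_card_image S t fun z _ => ?_
    calc (S.filter fun s => f s = z).card
        ≤ (Polynomial.nthRoots t z).toFinset.card := by
          refine card_le_card_of_injOn (fun s => -s⁻¹) (fun s hs => ?_) ?_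
          · simp only [coe_filter, Set.mem_ofPred_eq] at hs
            simpa [Polynomial.mem_nthRoots hpos] using hs.2
          · intro x _ y _ hxy
            exact inv_injective (neg_injective hxy)
      _ ≤ t := (Multiset.toFinset_card_le _).trans (Polynomial.card_nthRoots _ _)
  by_cases hq : 512 ^ 2 * C.card ^ 2 ≤ t
  · have := cube_mul_card_le_of_le_card hC0 htp htp2 hq hm hcountC
    calc m ^ 3 * S.card ≤ m ^ 3 * (t * C.card) := Nat.mul_le_mul_left _ hSC
      _ = t * (m ^ 3 * C.card) := by ring
      _ ≤ t * (2 ^ 18 * t ^ 2) := Nat.mul_le_mul_left _ this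
      _ ≤ 2 ^ 19 * t ^ 3 := by nlinarith [Nat.zero_le (t ^ 3)]
  · set q := Nat.sqrt t / 512 with hqdef
    have hq1 : 1 ≤ q := by
      refine (Nat.one_le_div_iff (by norm_num)).2 ?_
      rw [Nat.le_sqrt']
      exact ht
    have hqle : 512 ^ 2 * q ^ 2 ≤ t := by
      have h2 : 512 * q ≤ Nat.sqrt t := Nat.mul_div_le _ _
      have h3 := Nat.pow_le_pow_left h2 2
      have h4 := Nat.sqrt_le' t
      nlinarith
    have hqge : t ≤ 2 ^ 20 * q ^ 2 := by
      have h2 : Nat.sqrt t + 1 ≤ 512 * (q + 1) := by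
        have := Nat.lt_mul_div_succ (Nat.sqrt t) (show 0 < 512 by norm_num)
        omega
      have h3 := Nat.lt_succ_sqrt' t
      have h4 := Nat.pow_le_pow_left (show Nat.sqrt t + 1 ≤ 1024 * q by omega) 2
      rw [Nat.succ_eq_add_one] at h3
      nlinarith
    have hqC : q ≤ C.card := by
      by_contra! hlt
      exact hq ((Nat.mul_le_mul_left _ (Nat.pow_le_pow_left hlt.le 2)).trans hqle)
    obtain ⟨C', hC', hcard⟩ := exists_subset_card_eq hqC
    have h2 := cube_mul_card_le_of_le_card (fun h => hC0 (hC' h)) htp htp2 (by rwa [hcard]) hm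
      fun z hz => hcountC z (hC' hz)
    rw [hcard] at h2
    have hm2 : m ^ 2 ≤ 2 ^ 19 * t := by
      refine le_of_pow_le_pow_left₀ (n := 3) (by norm_num) (Nat.zero_le _) ?_
      refine le_of_mul_le_mul_right (a := t) ?_ hpos
      calc (m ^ 2) ^ 3 * t ≤ (m ^ 2) ^ 3 * (2 ^ 20 * q ^ 2) := Nat.mul_le_mul_left _ hqge
        _ = 2 ^ 20 * (m ^ 3 * q) ^ 2 := by ring
        _ ≤ 2 ^ 20 * (2 ^ 18 * t ^ 2) ^ 2 :=
          Nat.mul_le_mul_left _ (Nat.pow_le_pow_left h2 2)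
        _ ≤ (2 ^ 19 * t) ^ 3 * t := by nlinarith [Nat.zero_le (t ^ 4)]
    calc m ^ 3 * S.card = m ^ 2 * (m * S.card) := by ring
      _ ≤ (2 ^ 19 * t) * t ^ 2 := Nat.mul_le_mul hm2 hmark
      _ = 2 ^ 19 * t ^ 3 := by ring

theorem sum_diffCount_cube_le {p : ℕ} [Fact p.Prime] {G : Finset (ZMod p)}
    (h0 : (0 : ZMod p) ∉ G) (h1 : (1 : ZMod p) ∈ G) (hmul : ∀ x ∈ G, ∀ y ∈ G, x * y ∈ G)
    (ht : 512 ^ 2 ≤ G.card) (htp : G.card ^ 3 ≤ p ^ 2) (htp2 : 2 * G.card ≤ p) :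
    (∑ s, (diffCount G s : ℝ) ^ 3) ≤ 2 ^ 22 * (G.card : ℝ) ^ 3 * Real.log p := by
  set t := G.card with htdef
  have hle : ∀ s, diffCount G s ≤ t := fun s => card_filter_le _ _
  have hcube : ∀ n : ℕ, (n : ℝ) ^ 3 ≤ ∑ m ∈ Icc 1 n, 3 * (m : ℝ) ^ 2 := by
    intro n
    induction n with
    | zero => simp
    | succ n ih =>
      rw [sum_Icc_succ_top (by omega)]
      push_cast
      nlinarith [(Nat.cast_nonneg n : (0 : ℝ) ≤ n)]
  have hlevel : ∀ s, (diffCount G s : ℝ) ^ 3 ≤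
      ∑ m ∈ Icc 1 t, if m ≤ diffCount G s then 3 * (m : ℝ) ^ 2 else 0 := by
    intro s
    refine (hcube _).trans (le_of_eq ?_)
    rw [← sum_filter]
    congr 1
    ext m
    have := hle s
    simp only [mem_Icc, mem_filter]
    omega
  have hsum : ∑ s ∈ univ.erase (0 : ZMod p), (diffCount G s : ℝ) ^ 3 ≤
      ∑ m ∈ Icc 1 t, 3 * 2 ^ 19 * (t : ℝ) ^ 3 * (m : ℝ)⁻¹ := by
    refine (sum_le_sum fun s _ => hlevel s).trans ?_
    rw [sum_comm]
    refine sum_le_sum fun m hm => ?_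
    have hm1 : 0 < m := (mem_Icc.1 hm).1
    rw [← sum_filter, sum_const, nsmul_eq_mul, ← div_eq_mul_inv, le_div_iff₀ (by positivity)]
    have hfil : ((univ.erase (0 : ZMod p)).filter fun s => m ≤ diffCount G s) =
        univ.filter fun s : ZMod p => s ≠ 0 ∧ m ≤ diffCount G s := by
      ext s; simp
    rw [hfil]
    have := cube_mul_card_le_diffCount_le h0 h1 hmul ht htp htp2 m
    rw [← htdef] at this
    have h2 : (m : ℝ) ^ 3 * ((univ.filter fun s : ZMod p => s ≠ 0 ∧ m ≤ diffCount G s).card : ℝ)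
      ≤ 2 ^ 19 * (t : ℝ) ^ 3 := by exact_mod_cast this
    linarith
  have hharm : ∑ m ∈ Icc 1 t, (m : ℝ)⁻¹ ≤ 1 + Real.log t := by
    have := harmonic_le_one_add_log t
    rw [harmonic_eq_sum_Icc] at this
    push_cast at this
    exact this
  have htpos : (0 : ℝ) < t := by exact_mod_cast (by omega : 0 < t)
  have hlog : Real.log t ≤ Real.log p :=
    Real.log_le_log htpos (by exact_mod_cast (by omega : t ≤ p))
  have hlog1 : 1 ≤ Real.log p := by
    rw [Real.le_log_iff_exp_le (by exact_mod_cast (by omega : 0 < p))]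
    have : (3 : ℝ) ≤ p := by exact_mod_cast (by omega : 3 ≤ p)
    linarith [Real.exp_one_lt_d9]
  rw [← add_sum_erase _ _ (mem_univ (0 : ZMod p))]
  rw [← mul_sum] at hsum
  have hzero : (diffCount G 0 : ℝ) ^ 3 ≤ (t : ℝ) ^ 3 := by
    gcongr
    exact_mod_cast hle 0
  have h3 : 3 * 2 ^ 19 * (t : ℝ) ^ 3 * ∑ m ∈ Icc 1 t, (m : ℝ)⁻¹ ≤
      3 * 2 ^ 19 * (t : ℝ) ^ 3 * (2 * Real.log p) := by
    gcongr
    linarith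
  have h4 : (t : ℝ) ^ 3 ≤ (t : ℝ) ^ 3 * Real.log p := le_mul_of_one_le_right (by positivity) hlog1
  linarith [pow_pos htpos 3]

theorem sum_norm_sq_sum_mul_of_orthogonal {V : Type*} [Fintype V] [DecidableEq V]
    {k : V → V → ℂ} {q : ℝ}
    (hk : ∀ a a', ∑ b, k a b * starRingEnd ℂ (k a' b) = if a = a' then (q : ℂ) else 0)
    (f : V → ℂ) : ∑ b, ‖∑ a, f a * k a b‖ ^ 2 = q * ∑ a, ‖f a‖ ^ 2 := by
  apply Complex.ofReal_injective
  push_cast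
  simp_rw [← Complex.mul_conj', map_sum, map_mul, sum_mul_sum]
  calc ∑ b, ∑ a, ∑ a', f a * k a b * (starRingEnd ℂ (f a') * starRingEnd ℂ (k a' b))
      = ∑ a, ∑ a', f a * starRingEnd ℂ (f a') * ∑ b, k a b * starRingEnd ℂ (k a' b) := by
        rw [sum_comm]
        refine sum_congr rfl fun a _ => ?_
        rw [sum_comm]
        refine sum_congr rfl fun a' _ => ?_
        rw [mul_sum]
        exact sum_congr rfl fun b _ => by ring
    _ = _ := by
        simp_rw [hk]
        simp [mul_sum, mul_comm]

/-- The exponential sum of a finite set modulo `p` at frequency `ξ`. -/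
noncomputable def expSum {p : ℕ} [Fact p.Prime] (B : Finset (ZMod p)) (ξ : ZMod p) : ℂ :=
  ∑ x ∈ B, ZMod.stdAddChar (x * ξ)

theorem sum_stdAddChar_mul {p : ℕ} [Fact p.Prime] (b : ZMod p) :
    ∑ ξ : ZMod p, (ZMod.stdAddChar (b * ξ) : ℂ) = if b = 0 then (p : ℂ) else 0 := by
  have := AddChar.sum_mulShift b (ZMod.isPrimitive_stdAddChar p)
  simp_rw [mul_comm b]
  rw [this, ZMod.card]
  split_ifs <;> simp

theorem conj_stdAddChar {p : ℕ} [Fact p.Prime] (x : ZMod p) :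
    starRingEnd ℂ (ZMod.stdAddChar x) = ZMod.stdAddChar (-x) :=
  (AddChar.map_neg_eq_conj _ _).symm

theorem expSum_zero {p : ℕ} [Fact p.Prime] (B : Finset (ZMod p)) : expSum B 0 = B.card := by
  simp [expSum]

theorem sum_norm_sq_expSum {p : ℕ} [Fact p.Prime] (B : Finset (ZMod p)) :
    ∑ ξ, ‖expSum B ξ‖ ^ 2 = p * B.card := by
  have := sum_norm_sq_sum_mul_of_orthogonal (V := ZMod p) (q := p)
    (k := fun a b => ZMod.stdAddChar (a * b)) (fun a a' => ?_) (fun x => if x ∈ B then 1 else 0)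
  · simpa [expSum, ite_pow, apply_ite norm] using this
  · simp_rw [conj_stdAddChar, ← AddChar.map_add_eq_mul]
    have h := sum_stdAddChar_mul (a - a')
    simp_rw [sub_eq_zero, sub_mul, sub_eq_add_neg] at h
    rw [h]
    simp

theorem image_mul_left_eq_self {p : ℕ} [Fact p.Prime] {B : Finset (ZMod p)} {c : ZMod p}
    (hc : c ≠ 0) (hB : ∀ x ∈ B, c * x ∈ B) : B.image (c * ·) = B :=
  eq_of_subset_of_card_le (image_subset_iff.2 hB)
    (card_image_of_injective _ (mul_right_injective₀ hc)).ge

theorem expSum_mul {p : ℕ} [Fact p.Prime] {B : Finset (ZMod p)} {c : ZMod p}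
    (hc : c ≠ 0) (hB : ∀ x ∈ B, c * x ∈ B) (ξ : ZMod p) : expSum B (c * ξ) = expSum B ξ := by
  conv_rhs => rw [expSum, ← image_mul_left_eq_self hc hB]
  rw [sum_image fun a _ b _ h => mul_right_injective₀ hc h, expSum]
  exact sum_congr rfl fun x _ => by ring_nf

theorem card_mul_norm_sq_expSum_le {p : ℕ} [Fact p.Prime] {G B : Finset (ZMod p)}
    (h0 : (0 : ZMod p) ∉ G) (hB : ∀ c ∈ G, ∀ x ∈ B, c * x ∈ B) {ξ : ZMod p} (hξ : ξ ≠ 0) :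
    G.card * ‖expSum B ξ‖ ^ 2 ≤ p * B.card := by
  rw [← sum_norm_sq_expSum, ← nsmul_eq_mul, ← sum_const]
  calc ∑ c ∈ G, ‖expSum B ξ‖ ^ 2 = ∑ c ∈ G, ‖expSum B (c * ξ)‖ ^ 2 :=
        sum_congr rfl fun c hc => by rw [expSum_mul (fun h => h0 (h ▸ hc)) (hB c hc)]
    _ = ∑ η ∈ G.image (· * ξ), ‖expSum B η‖ ^ 2 := by
        rw [sum_image fun a _ b _ h => mul_left_injective₀ hξ h]
    _ ≤ _ := sum_le_sum_of_subset_of_nonneg (subset_univ _) fun _ _ _ => by positivity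

/-- The number of `y ∈ G` with `y + a ∈ G` and `y - b ∈ G`. -/
def tripleCount {p : ℕ} (G : Finset (ZMod p)) (v : ZMod p × ZMod p) : ℕ :=
  (G.filter fun y => y + v.1 ∈ G ∧ y - v.2 ∈ G).card

theorem sum_sum_sum_eq_sum_tripleCount {p : ℕ} [Fact p.Prime] {R : Type*} [CommRing R]
    (G : Finset (ZMod p)) (φ : ZMod p × ZMod p → R) :
    ∑ x ∈ G, ∑ y ∈ G, ∑ z ∈ G, φ (x - y, y - z) = ∑ v, tripleCount G v * φ v := by
  have h : ∀ v, (tripleCount G v : R) * φ v =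
      ∑ y ∈ G, if y + v.1 ∈ G then (if y - v.2 ∈ G then φ v else 0) else 0 := by
    intro v
    rw [tripleCount, card_filter, Nat.cast_sum, sum_mul]
    refine sum_congr rfl fun y _ => ?_
    split_ifs <;> simp_all
  simp_rw [h]
  conv_rhs => rw [sum_comm]
  rw [sum_comm]
  refine sum_congr rfl fun y _ => ?_
  rw [Fintype.sum_prod_type, Fintype.sum_equiv (Equiv.addLeft y)
    (fun a => ∑ b, if y + a ∈ G then (if y - b ∈ G then φ (a, b) else 0) else 0)
    (fun x => if x ∈ G then ∑ b, (if y - b ∈ G then φ (x - y, b) else 0) else 0)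
    fun a => by by_cases ha : y + a ∈ G <;> simp [ha]]
  rw [sum_ite_mem, univ_inter]
  refine sum_congr rfl fun x _ => ?_
  rw [Fintype.sum_equiv (Equiv.subLeft y) (fun b => if y - b ∈ G then φ (x - y, b) else 0)
    (fun z => if z ∈ G then φ (x - y, y - z) else 0) fun b => by simp]
  rw [sum_ite_mem, univ_inter]

theorem sum_tripleCount_sq {p : ℕ} [Fact p.Prime] (G : Finset (ZMod p)) :
    ∑ v, tripleCount G v ^ 2 = ∑ s, diffCount G s ^ 3 := by
  set g : ZMod p → ℕ := fun x => if x ∈ G then 1 else 0 with hg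
  have hd : ∀ s, diffCount G s = ∑ x, g x * g (x + s) := by
    intro s
    simp only [hg, ite_mul, one_mul, zero_mul]
    rw [diffCount, card_filter, sum_ite_mem, univ_inter]
  have ht : ∀ v, tripleCount G v = ∑ y, g y * g (y + v.1) * g (y - v.2) := by
    intro v
    simp only [hg, ite_mul, one_mul, zero_mul]
    rw [tripleCount, card_filter, sum_ite_mem, univ_inter]
    exact sum_congr rfl fun y _ => by rw [ite_and]
  have h1 : ∀ y z, ∑ a, g (y + a) * g (z + a) = diffCount G (z - y) := by
    intro y z
    rw [hd]
    refine Fintype.sum_equiv (Equiv.addLeft y) _ _ fun a => ?_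
    rw [Equiv.coe_addLeft, show y + a + (z - y) = z + a by ring]
  have h2 : ∀ y z, ∑ a, g (y - a) * g (z - a) = diffCount G (z - y) := by
    intro y z
    rw [hd]
    refine Fintype.sum_equiv (Equiv.subLeft y) _ _ fun a => ?_
    rw [Equiv.subLeft_apply, show y - a + (z - y) = z - a by ring]
  calc ∑ v, tripleCount G v ^ 2
      = ∑ y, ∑ z, g y * g z * ((∑ a, g (y + a) * g (z + a)) * ∑ b, g (y - b) * g (z - b)) := by
        simp_rw [ht, sq, sum_mul_sum]
        rw [sum_comm]
        refine sum_congr rfl fun y _ => ?_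
        rw [sum_comm]
        refine sum_congr rfl fun z _ => ?_
        rw [Fintype.sum_prod_type, mul_sum]
        refine sum_congr rfl fun a _ => ?_
        rw [mul_sum]
        exact sum_congr rfl fun b _ => by ring
    _ = ∑ y, ∑ s, g y * g (y + s) * diffCount G s ^ 2 := by
        simp_rw [h1, h2]
        refine sum_congr rfl fun y _ => ?_
        refine Fintype.sum_equiv (Equiv.subRight y) _ _ fun z => ?_
        rw [Equiv.subRight_apply, add_sub_cancel, sq]
    _ = _ := by
        rw [sum_comm]
        refine sum_congr rfl fun s _ => ?_
        rw [← sum_mul, ← hd]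
        ring

/-- The sixth power of an exponential sum over a multiplicatively closed set is at most `p` times
its third-moment additive energy. -/
theorem norm_expSum_pow_six_le {p : ℕ} [Fact p.Prime] {G : Finset (ZMod p)}
    (h0 : (0 : ZMod p) ∉ G) (h1 : (1 : ZMod p) ∈ G) (hmul : ∀ x ∈ G, ∀ y ∈ G, x * y ∈ G)
    {ξ : ZMod p} (hξ : ξ ≠ 0) :
    ‖expSum G ξ‖ ^ 6 ≤ p * ∑ s, (diffCount G s : ℝ) ^ 3 := by
  set e : ZMod p → ℂ := fun x => ZMod.stdAddChar x with he
  have hadd : ∀ x y, e (x + y) = e x * e y := fun x y => AddChar.map_add_eq_mul _ x y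
  have hconj : ∀ x, starRingEnd ℂ (e x) = e (-x) := conj_stdAddChar
  have hS : ∀ c ∈ G, expSum G (c * ξ) = expSum G ξ :=
    fun c hc => expSum_mul (fun h => h0 (h ▸ hc)) (hmul c hc) ξ
  set N : ZMod p × ZMod p → ℂ := fun v =>
    ∑ w ∈ G ×ˢ G, e (ξ * (v.1 * w.2 - w.1 * w.2 + w.1 * v.2)) with hN
  have hsum : ∑ v ∈ G ×ˢ G, N v =
      G.card * (expSum G ξ ^ 2 * starRingEnd ℂ (expSum G ξ)) := by
    have hw : ∀ w ∈ G ×ˢ G, ∑ v ∈ G ×ˢ G, e (ξ * (v.1 * w.2 - w.1 * w.2 + w.1 * v.2)) =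
        expSum G ξ ^ 2 * starRingEnd ℂ (e (w.1 * (w.2 * ξ))) := by
      intro w hw
      obtain ⟨hw1, hw2⟩ := mem_product.1 hw
      rw [hconj, sq]
      nth_rewrite 1 [← hS _ hw2]
      rw [← hS _ hw1, expSum, expSum, sum_mul_sum, sum_product, sum_mul]
      refine sum_congr rfl fun x _ => ?_
      rw [sum_mul]
      refine sum_congr rfl fun y _ => ?_
      change _ = e _ * e _ * _
      rw [← hadd, ← hadd]
      congr 1; ring
    rw [hN, sum_comm, sum_congr rfl hw, ← mul_sum, sum_product_right]
    have hb : ∀ b ∈ G, ∑ y ∈ G, starRingEnd ℂ (e (y * (b * ξ))) =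
        starRingEnd ℂ (expSum G ξ) := fun b hb => by
      rw [← map_sum, ← hS b hb]; rfl
    rw [sum_congr rfl hb, sum_const, nsmul_eq_mul]
    ring
  have hcs : (G.card : ℝ) ^ 2 * ‖expSum G ξ‖ ^ 6 ≤
      (G.card : ℝ) ^ 2 * ∑ v ∈ G ×ˢ G, ‖N v‖ ^ 2 := by
    have hn : ‖∑ v ∈ G ×ˢ G, N v‖ = G.card * ‖expSum G ξ‖ ^ 3 := by
      rw [hsum, norm_mul, norm_mul, norm_pow, Complex.norm_natCast, RCLike.norm_conj]
      ring
    calc (G.card : ℝ) ^ 2 * ‖expSum G ξ‖ ^ 6 = ‖∑ v ∈ G ×ˢ G, N v‖ ^ 2 := by rw [hn]; ring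
      _ ≤ (∑ v ∈ G ×ˢ G, ‖N v‖) ^ 2 := by gcongr; exact norm_sum_le _ _
      _ ≤ (G ×ˢ G).card * ∑ v ∈ G ×ˢ G, ‖N v‖ ^ 2 := sq_sum_le_card_mul_sum_sq
      _ = _ := by rw [card_product]; push_cast; ring
  have hG : (0 : ℝ) < G.card := by exact_mod_cast card_pos.2 ⟨1, h1⟩
  refine (le_of_mul_le_mul_left hcs (by positivity)).trans ?_
  set k : ZMod p × ZMod p → ZMod p × ZMod p → ℂ :=
    fun a b => e (ξ * (a.1 * b.1 - a.2 * b.2)) with hk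
  have hexp : ((∑ v ∈ G ×ˢ G, ‖N v‖ ^ 2 : ℝ) : ℂ) =
      ∑ b, (tripleCount G b : ℂ) * ∑ a, (tripleCount G a : ℂ) * k a b := by
    simp_rw [← sum_sum_sum_eq_sum_tripleCount G]
    push_cast
    simp_rw [← Complex.mul_conj', hN, map_sum, hconj, sum_mul_sum, ← hadd]
    simp_rw [hk, ← sum_product']
    refine sum_nbij' (fun t => (t.2.1.2, t.2.2.2, t.1.2, t.1.1, t.2.1.1, t.2.2.1))
      (fun t => ((t.2.2.2.1, t.2.2.1), ((t.2.2.2.2.1, t.1), (t.2.2.2.2.2, t.2.1)))) ?_ ?_ ?_ ?_ ?_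
    · simp; tauto
    · simp; tauto
    · simp
    · simp
    · intro t _
      simp only
      congr 1; ring
  have horth : ∀ a a', ∑ b, k a b * starRingEnd ℂ (k a' b) =
      if a = a' then (((p : ℝ) ^ 2 : ℝ) : ℂ) else 0 := by
    intro a a'
    have hsplit : ∀ b, k a b * starRingEnd ℂ (k a' b) =
        e (ξ * (a.1 - a'.1) * b.1) * e (ξ * (a'.2 - a.2) * b.2) := by
      intro b
      rw [hk]
      simp only
      rw [hconj, ← hadd, ← hadd]
      congr 1; ring
    simp_rw [hsplit]
    rw [Fintype.sum_prod_type]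
    simp_rw [← mul_sum]
    rw [← sum_mul]
    have h1 := sum_stdAddChar_mul (ξ * (a.1 - a'.1))
    have h2 := sum_stdAddChar_mul (ξ * (a'.2 - a.2))
    simp only [he, h1, h2, mul_eq_zero, hξ, false_or, sub_eq_zero, Prod.ext_iff]
    by_cases h3 : a.1 = a'.1 <;> by_cases h4 : a.2 = a'.2 <;> simp [h3, h4, sq, eq_comm]
  set E := ∑ s, (diffCount G s : ℝ) ^ 3 with hE
  have hE' : ∑ v, (tripleCount G v : ℝ) ^ 2 = E := by
    rw [hE]
    exact_mod_cast sum_tripleCount_sq G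
  have hE0 : 0 ≤ E := sum_nonneg fun _ _ => by positivity
  have hpars := sum_norm_sq_sum_mul_of_orthogonal horth fun v => (tripleCount G v : ℂ)
  simp only [Complex.norm_natCast, hE'] at hpars
  have hle : ∑ v ∈ G ×ˢ G, ‖N v‖ ^ 2 ≤
      ∑ b, (tripleCount G b : ℝ) * ‖∑ a, (tripleCount G a : ℂ) * k a b‖ := by
    have h2 := congrArg norm hexp
    rw [Complex.norm_real, Real.norm_of_nonneg (sum_nonneg fun _ _ => by positivity)] at h2
    rw [h2]
    refine (norm_sum_le _ _).trans_eq (sum_congr rfl fun b _ => ?_)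
    rw [norm_mul, Complex.norm_natCast]
  refine hle.trans (le_of_pow_le_pow_left₀ two_ne_zero (by positivity) ?_)
  refine (sum_mul_sq_le_sq_mul_sq _ _ _).trans_eq ?_
  rw [hpars, hE']
  ring

/-- Lower bound for the number of additive triples in a set containing all differences of `G`. -/
theorem card_pow_six_le_card_mul_sum_diffCount_cube {p : ℕ} [Fact p.Prime] {G A : Finset (ZMod p)}
    (hA : ∀ x ∈ G, ∀ y ∈ G, x - y ∈ A) :
    G.card ^ 6 ≤ ((A ×ˢ A).filter fun v => v.1 + v.2 ∈ A).card * ∑ s, diffCount G s ^ 3 := by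
  set D := (A ×ˢ A).filter fun v => v.1 + v.2 ∈ A with hD
  have hsupp : ∀ v ∉ D, tripleCount G v = 0 := by
    intro v hv
    by_contra h
    obtain ⟨y, hy⟩ := card_pos.1 (Nat.pos_of_ne_zero h)
    simp only [mem_filter] at hy
    obtain ⟨hy, h1, h2⟩ := hy
    refine hv (mem_filter.2 ⟨mem_product.2 ⟨?_, ?_⟩, ?_⟩)
    · simpa using hA _ h1 _ hy
    · simpa using hA _ hy _ h2
    · have := hA _ h1 _ h2
      rwa [show y + v.1 - (y - v.2) = v.1 + v.2 by ring] at this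
  have hsum : ∑ v ∈ D, tripleCount G v = G.card ^ 3 := by
    rw [sum_subset (subset_univ D) fun v _ hv => hsupp v hv]
    have := sum_sum_sum_eq_sum_tripleCount (R := ℤ) G fun _ => 1
    simp only [sum_const, mul_one, nsmul_eq_mul] at this
    have h : ((∑ v, tripleCount G v : ℕ) : ℤ) = ((G.card ^ 3 : ℕ) : ℤ) := by
      push_cast
      rw [← this]
      ring
    exact_mod_cast h
  calc G.card ^ 6 = (∑ v ∈ D, tripleCount G v) ^ 2 := by rw [hsum]; ring
    _ ≤ D.card * ∑ v ∈ D, tripleCount G v ^ 2 := sq_sum_le_card_mul_sum_sq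
    _ ≤ D.card * ∑ v, tripleCount G v ^ 2 := by
        gcongr
        exact subset_univ D
    _ = _ := by rw [sum_tripleCount_sq]

/-- Fourier-analytic upper bound for the number of additive triples in a set. -/
theorem mul_card_filter_add_mem_le {p : ℕ} [Fact p.Prime] {A : Finset (ZMod p)} {H : ℝ}
    (hH : ∀ ξ ≠ 0, ‖expSum A ξ‖ ≤ H) :
    (p : ℝ) * ((A ×ˢ A).filter fun v => v.1 + v.2 ∈ A).card ≤
      (A.card : ℝ) ^ 3 + H * (p * A.card) := by
  have hcount : ((p * ((A ×ˢ A).filter fun v => v.1 + v.2 ∈ A).card : ℕ) : ℂ) =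
      ∑ ξ, expSum A ξ ^ 2 * starRingEnd ℂ (expSum A ξ) := by
    have hterm : ∀ ξ, expSum A ξ ^ 2 * starRingEnd ℂ (expSum A ξ) =
        ∑ v ∈ A ×ˢ A, ∑ c ∈ A, (ZMod.stdAddChar ((v.1 + v.2 - c) * ξ) : ℂ) := by
      intro ξ
      rw [sq, expSum, sum_mul_sum, ← sum_product', map_sum, sum_mul_sum]
      refine sum_congr rfl fun v _ => sum_congr rfl fun c _ => ?_
      rw [conj_stdAddChar, ← AddChar.map_add_eq_mul, ← AddChar.map_add_eq_mul]
      congr 1; ring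
    simp_rw [hterm]
    rw [sum_comm, card_filter]
    push_cast
    rw [mul_sum]
    refine sum_congr rfl fun v _ => ?_
    rw [sum_comm]
    simp_rw [sum_stdAddChar_mul, sub_eq_zero]
    simp
  have hnorm := congrArg norm hcount
  rw [Complex.norm_natCast] at hnorm
  push_cast at hnorm
  have hH0 : 0 ≤ H := (norm_nonneg _).trans (hH 1 one_ne_zero)
  rw [hnorm, ← sum_norm_sq_expSum, mul_sum, ← add_sum_erase _ _ (mem_univ (0 : ZMod p))]
  refine (norm_add_le _ _).trans (add_le_add ?_ ?_)
  · rw [norm_mul, norm_pow, RCLike.norm_conj, expSum_zero, Complex.norm_natCast]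
    exact (by ring : _ = _).le
  · refine (norm_sum_le _ _).trans ?_
    refine (sum_le_sum fun ξ hξ => ?_).trans
      (sum_le_sum_of_subset_of_nonneg (subset_univ _) fun _ _ _ => by positivity)
    rw [norm_mul, norm_pow, RCLike.norm_conj, mul_comm]
    exact mul_le_mul_of_nonneg_right (hH ξ (ne_of_mem_erase hξ)) (by positivity)

theorem card_mul_card_sq_le_of_forall_ne {p : ℕ} [Fact p.Prime] {A G : Finset (ZMod p)}
    {c : ZMod p} (hc : c ≠ 0) (hA : A.Nonempty)
    (hne : ∀ a ∈ A, ∀ b ∈ A, ∀ x ∈ G, ∀ y ∈ G, a + b + x ≠ c * y) {m : ℝ}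
    (hm : ∀ ξ ≠ 0, ‖expSum G ξ‖ ^ 2 ≤ m) :
    (A.card : ℝ) * (G.card : ℝ) ^ 2 ≤ p * m := by
  have hzero : ∑ ξ, expSum A ξ ^ 2 * (expSum G ξ * starRingEnd ℂ (expSum G (c * ξ))) = 0 := by
    have hterm : ∀ ξ, expSum A ξ ^ 2 * (expSum G ξ * starRingEnd ℂ (expSum G (c * ξ))) =
        ∑ v ∈ A ×ˢ A, ∑ w ∈ G ×ˢ G,
          (ZMod.stdAddChar ((v.1 + v.2 + w.1 - c * w.2) * ξ) : ℂ) := by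
      intro ξ
      rw [sq, expSum, sum_mul_sum, ← sum_product', expSum, expSum, map_sum, sum_mul_sum,
        ← sum_product', sum_mul_sum]
      refine sum_congr rfl fun v _ => sum_congr rfl fun w _ => ?_
      rw [conj_stdAddChar, ← AddChar.map_add_eq_mul, ← AddChar.map_add_eq_mul,
        ← AddChar.map_add_eq_mul]
      congr 1; ring
    simp_rw [hterm]
    rw [sum_comm]
    refine sum_eq_zero fun v hv => ?_
    rw [sum_comm]
    refine sum_eq_zero fun w hw => ?_
    rw [mem_product] at hv hw
    rw [sum_stdAddChar_mul, if_neg (sub_ne_zero.2 (hne _ hv.1 _ hv.2 _ hw.1 _ hw.2))]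
  rw [← add_sum_erase _ _ (mem_univ (0 : ZMod p)), mul_zero, add_eq_zero_iff_eq_neg] at hzero
  have hnorm := congrArg norm hzero
  rw [norm_neg, norm_mul, norm_mul, norm_pow, RCLike.norm_conj, expSum_zero, expSum_zero,
    Complex.norm_natCast, Complex.norm_natCast] at hnorm
  have hm0 : 0 ≤ m := (sq_nonneg _).trans (hm 1 one_ne_zero)
  have hle : (A.card : ℝ) ^ 2 * (G.card * G.card) ≤ m * (p * A.card) := by
    rw [hnorm, ← sum_norm_sq_expSum, mul_sum]
    refine (norm_sum_le _ _).trans ((sum_le_sum fun ξ hξ => ?_).trans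
      (sum_le_sum_of_subset_of_nonneg (subset_univ _) fun _ _ _ => by positivity))
    have h0 := ne_of_mem_erase hξ
    rw [norm_mul, norm_mul, norm_pow, RCLike.norm_conj, mul_comm]
    refine mul_le_mul_of_nonneg_right ?_ (by positivity)
    nlinarith [hm ξ h0, hm (c * ξ) (mul_ne_zero hc h0),
      sq_nonneg (‖expSum G ξ‖ - ‖expSum G (c * ξ)‖)]
  have hApos : (0 : ℝ) < A.card := by exact_mod_cast card_pos.2 hA
  refine le_of_mul_le_mul_left ?_ hApos
  calc (A.card : ℝ) * (A.card * (G.card : ℝ) ^ 2) = (A.card : ℝ) ^ 2 * (G.card * G.card) := by ring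
    _ ≤ _ := hle
    _ = _ := by ring

theorem card_pow_three_le_of_forall_ne {p : ℕ} [Fact p.Prime] {A G : Finset (ZMod p)}
    {c : ZMod p} (hc : c ≠ 0) (h0 : (0 : ZMod p) ∉ G) (h1 : (1 : ZMod p) ∈ G)
    (hmul : ∀ x ∈ G, ∀ y ∈ G, x * y ∈ G) (hA : ∀ x ∈ G, ∀ y ∈ G, x - y ∈ A)
    (hne : ∀ a ∈ A, ∀ b ∈ A, ∀ x ∈ G, ∀ y ∈ G, a + b + x ≠ c * y) :
    G.card ^ 3 ≤ p ^ 2 := by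
  have hGpos : (0 : ℝ) < G.card := by exact_mod_cast card_pos.2 ⟨1, h1⟩
  have hm : ∀ ξ ≠ 0, ‖expSum G ξ‖ ^ 2 ≤ (p : ℝ) := fun ξ hξ => by
    refine le_of_mul_le_mul_left ?_ hGpos
    rw [mul_comm _ (p : ℝ)]
    exact card_mul_norm_sq_expSum_le h0 hmul hξ
  have h := card_mul_card_sq_le_of_forall_ne hc ⟨_, hA 1 h1 1 h1⟩ hne hm
  have hcard : G.card ≤ A.card :=
    card_le_card_of_injOn (· - 1) (fun x hx => hA x hx 1 h1) fun x _ y _ hxy => by simpa using hxy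
  have hcard' : (G.card : ℝ) ≤ A.card := by exact_mod_cast hcard
  have : (G.card : ℝ) ^ 3 ≤ (p : ℝ) ^ 2 := by
    nlinarith [mul_le_mul_of_nonneg_right hcard' (sq_nonneg (G.card : ℝ))]
  exact_mod_cast this

theorem pow_six_lt_of_energy_bounds {g a p L T E m H : ℝ} (hg : 0 < g) (ha : 0 ≤ a)
    (hp : 0 < p) (hL : 1 ≤ L) (hT : 0 ≤ T) (hm : m ^ 3 = p * E)
    (hgH : g * H ^ 2 = p * a) (hE : E ≤ 2 ^ 22 * g ^ 3 * L)
    (hag : a * g ^ 2 ≤ p * m) (hpT : p * T ≤ a ^ 3 + H * (p * a)) (hgT : g ^ 6 ≤ T * E) :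
    g ^ 6 < (10 * 2 ^ 22) ^ 6 * p ^ 3 * L ^ 2 := by
  have hL0 : 0 < L := by linarith
  have h3 : a ^ 3 * g ^ 3 ≤ p ^ 4 * (2 ^ 22 * L) := by
    refine le_of_mul_le_mul_right ?_ (pow_pos hg 3)
    calc a ^ 3 * g ^ 3 * g ^ 3 = (a * g ^ 2) ^ 3 := by ring
      _ ≤ (p * m) ^ 3 := by gcongr
      _ = p ^ 4 * E := by rw [mul_pow, hm]; ring
      _ ≤ p ^ 4 * (2 ^ 22 * g ^ 3 * L) := by gcongr
      _ = _ := by ring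
  have h4 : g ^ 3 ≤ T * (2 ^ 22 * L) := by
    refine le_of_mul_le_mul_right ?_ (pow_pos hg 3)
    calc g ^ 3 * g ^ 3 = g ^ 6 := by ring
      _ ≤ T * E := hgT
      _ ≤ T * (2 ^ 22 * g ^ 3 * L) := by gcongr
      _ = _ := by ring
  rcases le_total (H * (p * a)) (a ^ 3) with h | h
  · have h5 : p * g ^ 6 ≤ p * (2 * (2 ^ 22 * L) ^ 2 * p ^ 3) := by
      calc p * g ^ 6 = p * g ^ 3 * g ^ 3 := by ring
        _ ≤ p * (T * (2 ^ 22 * L)) * g ^ 3 := by gcongr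
        _ = p * T * (2 ^ 22 * L) * g ^ 3 := by ring
        _ ≤ (2 * a ^ 3) * (2 ^ 22 * L) * g ^ 3 := by
          have : p * T ≤ 2 * a ^ 3 := by linarith
          rel [this]
        _ = 2 * (2 ^ 22 * L) * (a ^ 3 * g ^ 3) := by ring
        _ ≤ 2 * (2 ^ 22 * L) * (p ^ 4 * (2 ^ 22 * L)) := by gcongr
        _ = _ := by ring
    refine (le_of_mul_le_mul_left h5 hp).trans_lt ?_
    calc 2 * (2 ^ 22 * L) ^ 2 * p ^ 3 = 2 * (2 ^ 22) ^ 2 * (p ^ 3 * L ^ 2) := by ring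
      _ < (10 * 2 ^ 22) ^ 6 * (p ^ 3 * L ^ 2) :=
        mul_lt_mul_of_pos_right (by norm_num) (by positivity)
      _ = _ := by ring
  · have h5 : T ≤ 2 * (H * a) := by
      refine le_of_mul_le_mul_left ?_ hp
      linarith
    have h6 : g ^ 10 ≤ 4 * (2 ^ 22 * L) ^ 3 * p ^ 5 := by
      calc g ^ 10 = (g ^ 3) ^ 2 * g ^ 4 := by ring
        _ ≤ (2 * (H * a) * (2 ^ 22 * L)) ^ 2 * g ^ 4 := by
          have : g ^ 3 ≤ 2 * (H * a) * (2 ^ 22 * L) := h4.trans (by gcongr)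
          gcongr
        _ = 4 * (2 ^ 22 * L) ^ 2 * a ^ 2 * g ^ 3 * (g * H ^ 2) := by ring
        _ = 4 * (2 ^ 22 * L) ^ 2 * p * (a ^ 3 * g ^ 3) := by rw [hgH]; ring
        _ ≤ 4 * (2 ^ 22 * L) ^ 2 * p * (p ^ 4 * (2 ^ 22 * L)) := by gcongr
        _ = _ := by ring
    refine lt_of_pow_lt_pow_left₀ 5 (by positivity) ?_
    calc (g ^ 6) ^ 5 = (g ^ 10) ^ 3 := by ring
      _ ≤ (4 * (2 ^ 22 * L) ^ 3 * p ^ 5) ^ 3 := by gcongr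
      _ = 64 * (2 ^ 22) ^ 9 * (p ^ 15 * L ^ 9) * 1 := by ring
      _ < (10 * 2 ^ 22) ^ 30 * (p ^ 15 * L ^ 9) * L := by
        refine mul_lt_mul ?_ hL one_pos (by positivity)
        refine mul_lt_mul_of_pos_right (by norm_num) (by positivity)
      _ = _ := by ring

theorem card_pow_six_lt_of_forall_ne {p : ℕ} [Fact p.Prime] (hp : 8 ≤ p)
    (hlog : 1 ≤ Real.log p) {G : Finset (ZMod p)} {c : ZMod p} (hc : c ≠ 0)
    (h0 : (0 : ZMod p) ∉ G) (h1 : (1 : ZMod p) ∈ G) (hmul : ∀ x ∈ G, ∀ y ∈ G, x * y ∈ G)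
    (hcard : 512 ^ 2 ≤ G.card)
    (hne : ∀ a₁ ∈ G, ∀ a₂ ∈ G, ∀ b₁ ∈ G, ∀ b₂ ∈ G, ∀ x ∈ G, ∀ y ∈ G,
      a₁ - a₂ + (b₁ - b₂) + x ≠ c * y) :
    (G.card : ℝ) ^ 6 < (10 * 2 ^ 22) ^ 6 * (p : ℝ) ^ 3 * Real.log p ^ 2 := by
  set A := image₂ (fun x y => x - y) G G with hAdef
  have hA : ∀ x ∈ G, ∀ y ∈ G, x - y ∈ A := fun x hx y hy => mem_image₂_of_mem hx hy
  have hAmul : ∀ c ∈ G, ∀ x ∈ A, c * x ∈ A := by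
    intro c hc x hx
    obtain ⟨y, hy, z, hz, rfl⟩ := mem_image₂.1 hx
    rw [mul_sub]
    exact hA _ (hmul c hc y hy) _ (hmul c hc z hz)
  have hneA : ∀ a ∈ A, ∀ b ∈ A, ∀ x ∈ G, ∀ y ∈ G, a + b + x ≠ c * y := by
    intro a ha b hb x hx y hy
    obtain ⟨a₁, ha₁, a₂, ha₂, rfl⟩ := mem_image₂.1 ha
    obtain ⟨b₁, hb₁, b₂, hb₂, rfl⟩ := mem_image₂.1 hb
    exact hne _ ha₁ _ ha₂ _ hb₁ _ hb₂ _ hx _ hy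
  have hcube := card_pow_three_le_of_forall_ne hc h0 h1 hmul hA hneA
  have htwo : 2 * G.card ≤ p := by
    refine le_of_pow_le_pow_left₀ three_ne_zero (Nat.zero_le _) ?_
    calc (2 * G.card) ^ 3 = 8 * G.card ^ 3 := by ring
      _ ≤ p * p ^ 2 := Nat.mul_le_mul hp hcube
      _ = p ^ 3 := by ring
  have hE := sum_diffCount_cube_le h0 h1 hmul hcard hcube htwo
  set E := ∑ s, (diffCount G s : ℝ) ^ 3 with hEdef
  have hE0 : 0 ≤ E := sum_nonneg fun _ _ => by positivity
  have hGpos : (0 : ℝ) < G.card := by exact_mod_cast card_pos.2 ⟨1, h1⟩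
  have hppos : (0 : ℝ) < p := by exact_mod_cast (by omega : 0 < p)
  set m : ℝ := (p * E) ^ ((3 : ℕ) : ℝ)⁻¹ with hm
  have hm0 : 0 ≤ m := by positivity
  have hm3 : m ^ 3 = p * E := Real.rpow_inv_natCast_pow (by positivity) three_ne_zero
  set H : ℝ := √(p * A.card / G.card) with hH
  have hH2 : H ^ 2 = p * A.card / G.card := Real.sq_sqrt (by positivity)
  have hgH : (G.card : ℝ) * H ^ 2 = p * A.card := by
    rw [hH2]
    field_simp
  have hmS : ∀ ξ ≠ 0, ‖expSum G ξ‖ ^ 2 ≤ m := fun ξ hξ => by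
    refine le_of_pow_le_pow_left₀ three_ne_zero hm0 ?_
    rw [hm3, ← pow_mul]
    exact norm_expSum_pow_six_le h0 h1 hmul hξ
  have hHA : ∀ ξ ≠ 0, ‖expSum A ξ‖ ≤ H := fun ξ hξ => by
    refine Real.le_sqrt_of_sq_le ((le_div_iff₀ hGpos).2 ?_)
    rw [mul_comm]
    exact card_mul_norm_sq_expSum_le h0 hAmul hξ
  have hsix := card_pow_six_le_card_mul_sum_diffCount_cube hA
  refine pow_six_lt_of_energy_bounds hGpos (Nat.cast_nonneg A.card) hppos hlog (Nat.cast_nonneg _)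
    hm3 hgH hE
    (card_mul_card_sq_le_of_forall_ne hc ⟨_, hA 1 h1 1 h1⟩ hneA hmS)
    (mul_card_filter_add_mem_le hHA) ?_
  rw [hEdef]
  exact_mod_cast hsix

/-- There exist an absolute constant `C > 0` and a threshold `p₀` such that for
every prime `p > p₀` and every multiplicative subgroup `Γ ⊆ F_p^*` with `-1 ∈ Γ` and
`|Γ| ≥ C · p^{1/2} · (log p)^{1/3}`, every nonzero element of `F_p` is a sum of five
elements of `Γ`. -/
theorem stmt1 :
    ∃ C : ℝ, 0 < C ∧ ∃ p₀ : ℕ,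
      ∀ (p : ℕ) [Fact p.Prime], p₀ < p →
        ∀ Γ : Finset (ZMod p),
          (0 : ZMod p) ∉ Γ → (1 : ZMod p) ∈ Γ →
          (∀ x ∈ Γ, ∀ y ∈ Γ, x * y ∈ Γ) → (∀ x ∈ Γ, x⁻¹ ∈ Γ) →
          (-1 : ZMod p) ∈ Γ →
          C * (p : ℝ) ^ ((1 : ℝ) / 2) * (Real.log p) ^ ((1 : ℝ) / 3) ≤ (Γ.card : ℝ) →
          ∀ x : ZMod p, x ≠ 0 →
            ∃ a ∈ Γ, ∃ b ∈ Γ, ∃ c ∈ Γ, ∃ d ∈ Γ, ∃ e ∈ Γ, a + b + c + d + e = x := by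
  refine ⟨10 * 2 ^ 22, by norm_num, 8, ?_⟩
  intro p _ hp G h0 h1 hmul hinv hneg hcard c hc
  have hp1 : (1 : ℝ) ≤ p := by exact_mod_cast (by omega : 1 ≤ p)
  have hlog : 1 ≤ Real.log p := by
    rw [Real.le_log_iff_exp_le (by linarith)]
    have h8 : (8 : ℝ) ≤ p := by exact_mod_cast hp.le
    linarith [Real.exp_one_lt_d9]
  have hbig : (10 * 2 ^ 22 : ℝ) ≤ G.card := by
    refine le_trans ?_ hcard
    rw [mul_assoc]
    refine le_mul_of_one_le_right (by norm_num) ?_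
    exact one_le_mul_of_one_le_of_one_le (Real.one_le_rpow hp1 (by norm_num))
      (Real.one_le_rpow hlog (by norm_num))
  have h512 : 512 ^ 2 ≤ G.card := by
    have : (10 * 2 ^ 22 : ℕ) ≤ G.card := by exact_mod_cast hbig
    omega
  by_contra! hcon
  refine (card_pow_six_lt_of_forall_ne hp.le hlog hc h0 h1 hmul h512 ?_).not_ge ?_
  · intro a₁ ha₁ a₂ ha₂ b₁ hb₁ b₂ hb₂ x hx y hy h
    have hy0 : y ≠ 0 := fun h => h0 (h ▸ hy)
    have hy' := hmul _ hneg _ (hinv y hy)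
    refine hcon _ (hmul _ (hinv y hy) _ ha₁) _ (hmul _ hy' _ ha₂) _ (hmul _ (hinv y hy) _ hb₁) _
      (hmul _ hy' _ hb₂) _ (hmul _ (hinv y hy) _ hx) ?_
    calc _ = y⁻¹ * (a₁ - a₂ + (b₁ - b₂) + x) := by ring
      _ = c := by rw [h, mul_comm c, inv_mul_cancel_left₀ hy0]
  · have hpow := pow_le_pow_left₀ (by positivity) hcard 6
    rw [mul_pow, mul_pow, ← Real.rpow_mul_natCast (by linarith),
      ← Real.rpow_mul_natCast (by linarith)] at hpow
    norm_num at hpow ⊢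
    exact_mod_cast hpow
end

section
/- There exist absolute constants c > 0 and C > 0 such that for every prime p, every multiplicative subgroup Γ of F_p^*, and all Γ-invariant sets Q, Q₁ ⊆ F_p^* with |Q||Q₁| ≤ c|Γ|^4 and |Q||Q₁||Γ|^2 ≤ c p^3, one has Σ_{x ∈ Γ} (Q ∘ Q₁)(x) ≤ C · |Γ|^{1/3} · |Q|^{2/3} · |Q₁|^{2/3}. -/
open Finset

/-- `(A ∘ B)(x)` = number of `y` with `y ∈ A` and `y + x ∈ B`. -/
def convAB {p : ℕ} (A B : Finset (ZMod p)) (x : ZMod p) : ℕ :=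
  (A.filter fun y => y + x ∈ B).card

section Stepanov

open Polynomial

variable {F : Type*} [Field F]

/-- In characteristic `p`, a polynomial of degree less than `p` with at most `s` nonzero
coefficients cannot vanish to order `s` at a nonzero point. -/
theorem Polynomial.eq_zero_of_sub_C_pow_card_dvd {p : ℕ} [CharP F p] {a : F} (ha : a ≠ 0)
    (S : Finset ℕ) (hS : ∀ e ∈ S, e < p) (f : F[X]) (hf : ∀ e ∉ S, f.coeff e = 0)
    (hdvd : (X - C a) ^ S.card ∣ f) : f = 0 := by
  induction S using Finset.induction_on generalizing f with
  | empty => ext e; simpa using hf e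
  | insert e₀ S he₀ ih =>
    rw [Finset.card_insert_of_notMem he₀] at hdvd
    have hcoeff : ∀ e : ℕ, (X * derivative f - C (e₀ : F) * f).coeff e
        = ((e : F) - e₀) * f.coeff e := by
      intro e
      rcases e with _ | e
      · simp
      · simp [coeff_X_mul, coeff_derivative]; ring
    have hzero : X * derivative f - C (e₀ : F) * f = 0 := by
      refine ih (fun e he => hS e (Finset.mem_insert_of_mem he)) _ (fun e he => ?_) ?_
      · rw [hcoeff]
        by_cases h : e = e₀
        · simp [h]
        · rw [hf e (by simp [h, he]), mul_zero]
      · obtain ⟨g, rfl⟩ := hdvd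
        refine dvd_sub (Dvd.dvd.mul_left ?_ _) (Dvd.dvd.mul_left ?_ _)
        · rw [derivative_mul, derivative_X_sub_C_pow, Nat.add_sub_cancel]
          exact dvd_add (Dvd.intro_left _ rfl |>.mul_right _)
            ((pow_dvd_pow _ (Nat.le_succ _)).mul_right _)
        · exact (pow_dvd_pow _ (Nat.le_succ _)).mul_right _
    have hmono : f = C (f.coeff e₀) * X ^ e₀ := by
      ext e
      rw [coeff_C_mul_X_pow]
      split_ifs with h
      · rw [h]
      · by_cases he : e ∈ S
        · have h1 := hcoeff e
          rw [hzero, coeff_zero, eq_comm, mul_eq_zero] at h1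
          refine h1.resolve_left fun h2 => h ?_
          have h3 : (e : F) = (e₀ : F) := sub_eq_zero.1 h2
          rw [CharP.cast_eq_iff_mod_eq F p] at h3
          rwa [Nat.mod_eq_of_lt (hS e (Finset.mem_insert_of_mem he)),
            Nat.mod_eq_of_lt (hS e₀ (Finset.mem_insert_self _ _))] at h3
        · exact hf e (by simp [h, he])
    have hroot : f.eval a = 0 := by
      obtain ⟨g, rfl⟩ := hdvd
      simp
    rw [hmono] at hroot
    have h0 : f.coeff e₀ = 0 := by simpa [ha] using hroot
    rw [hmono, h0]; simp

/-- The derivation `X (X + 1) d/dX`. -/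
noncomputable def weightedDeriv (F : Type*) [Field F] : Module.End F F[X] :=
  LinearMap.mulLeft F (X * (X + 1)) ∘ₗ derivative

theorem weightedDeriv_apply (f : F[X]) :
    weightedDeriv F f = X * (X + 1) * derivative f := rfl

/-- The derivation `X (X + 1) d/dX` conjugated by `X ^ m * (X + 1) ^ n`. -/
noncomputable def twistedDeriv (F : Type*) [Field F] (m n : ℕ) : Module.End F F[X] :=
  weightedDeriv F + LinearMap.mulLeft F (C (m : F) * (X + 1) + C (n : F) * X)

theorem twistedDeriv_apply (m n : ℕ) (f : F[X]) :
    twistedDeriv F m n f =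
      X * (X + 1) * derivative f + (C (m : F) * (X + 1) + C (n : F) * X) * f := rfl

theorem weightedDeriv_mul (m n : ℕ) (f : F[X]) :
    weightedDeriv F (f * (X ^ m * (X + 1) ^ n)) =
      twistedDeriv F m n f * (X ^ m * (X + 1) ^ n) := by
  have hX : ∀ (Y : F[X]) (k : ℕ), derivative Y = 1 →
      Y * derivative (Y ^ k) = C (k : F) * Y ^ k := by
    intro Y k hY
    rcases k with _ | k
    · simp
    · rw [derivative_pow, hY, Nat.add_sub_cancel]; ring
  have h1 := hX X m derivative_X
  have h2 := hX (X + 1) n (by simp)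
  rw [weightedDeriv_apply, twistedDeriv_apply, derivative_mul, derivative_mul]
  linear_combination f * (X + 1) ^ n * (X + 1) * h1 + f * X * X ^ m * h2

theorem weightedDeriv_pow_mul (m n k : ℕ) (f : F[X]) :
    (weightedDeriv F ^ k) (f * (X ^ m * (X + 1) ^ n)) =
      (twistedDeriv F m n ^ k) f * (X ^ m * (X + 1) ^ n) := by
  induction k generalizing f with
  | zero => simp
  | succ k ih =>
    rw [pow_succ, pow_succ, Module.End.mul_apply, Module.End.mul_apply, weightedDeriv_mul, ih]

theorem natDegree_twistedDeriv_pow_le (m n k : ℕ) (f : F[X]) :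
    ((twistedDeriv F m n ^ k) f).natDegree ≤ f.natDegree + k := by
  induction k with
  | zero => simp
  | succ k ih =>
    rw [pow_succ', Module.End.mul_apply]
    set g := (twistedDeriv F m n ^ k) f
    have hg : (twistedDeriv F m n g).natDegree ≤ g.natDegree + 1 := by
      rw [twistedDeriv_apply]
      refine natDegree_add_le_of_degree_le ?_ ?_
      · by_cases h0 : g.natDegree = 0
        · rw [derivative_of_natDegree_zero h0]; simp
        · have h1 := natDegree_derivative_lt h0
          have h2 : (X * (X + 1) : F[X]).natDegree ≤ 2 := by compute_degree
          have h3 := natDegree_mul_le (p := (X * (X + 1) : F[X])) (q := derivative g)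
          omega
      · have h2 : (C (m : F) * (X + 1) + C (n : F) * X).natDegree ≤ 1 := by compute_degree
        have h3 := natDegree_mul_le (p := C (m : F) * (X + 1) + C (n : F) * X) (q := g)
        omega
    omega

/-- In characteristic `p`, vanishing of the first `D ≤ p` iterates of `X (X + 1) d/dX` at a point
other than `0` and `-1` forces a zero of order `D`. -/
theorem sub_C_pow_dvd_of_weightedDeriv {p : ℕ} [CharP F p] {x : F} (hx : x ≠ 0)
    (hx' : x + 1 ≠ 0) {D : ℕ} (hD : D ≤ p) (f : F[X])
    (hf : ∀ n < D, ((weightedDeriv F ^ n) f).eval x = 0) : (X - C x) ^ D ∣ f := by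
  induction D generalizing f with
  | zero => simp
  | succ D ih =>
    have h1 : (X - C x) ^ D ∣ f := ih (by omega) f fun n hn => hf n (by omega)
    have h2 : (X - C x) ^ D ∣ weightedDeriv F f := by
      refine ih (by omega) _ fun n hn => ?_
      rw [← Module.End.mul_apply, ← pow_succ]
      exact hf (n + 1) (by omega)
    rcases Nat.eq_zero_or_pos D with rfl | hpos
    · rw [zero_add, pow_one, dvd_iff_isRoot]
      simpa using hf 0 (by omega)
    obtain ⟨D, rfl⟩ := Nat.exists_eq_succ_of_ne_zero hpos.ne'
    obtain ⟨u, rfl⟩ := h1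
    have hexp : weightedDeriv F ((X - C x) ^ (D + 1) * u) = (X - C x) ^ D *
        (X * (X + 1) * (C ((D + 1 : ℕ) : F) * u + (X - C x) * derivative u)) := by
      rw [weightedDeriv_apply, derivative_mul, derivative_X_sub_C_pow, Nat.add_sub_cancel]
      ring
    rw [Nat.succ_eq_add_one, hexp, pow_succ,
      mul_dvd_mul_iff_left (pow_ne_zero _ (X_sub_C_ne_zero x)), dvd_iff_isRoot] at h2
    have hDne : ((D + 1 : ℕ) : F) ≠ 0 := fun h => by
      rw [CharP.cast_eq_zero_iff F p] at h
      exact absurd (Nat.le_of_dvd (by omega) h) (by omega)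
    have hu : u.eval x = 0 := by
      simp only [IsRoot, eval_mul, eval_add, eval_X, eval_one, eval_C, eval_sub, sub_self,
        zero_mul, add_zero, mul_eq_zero] at h2
      tauto
    rw [pow_succ]
    exact mul_dvd_mul_left _ (dvd_iff_isRoot.2 hu)

/-- Stepanov's auxiliary polynomial with coefficients `c`. -/
noncomputable def stepanovPoly (t : ℕ) {A B : ℕ} (c : Fin A × Fin B × Fin B → F) : F[X] :=
  ∑ v, c v • (X ^ (v.1 : ℕ) * (X ^ (t * v.2.1) * (X + 1) ^ (t * v.2.2)))

theorem stepanovPoly_ne_zero {p t A B : ℕ} [CharP F p] (hAB : A * B ≤ t) (htB : t * B ≤ p)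
    {c : Fin A × Fin B × Fin B → F} (hc : c ≠ 0) : stepanovPoly t c ≠ 0 := by
  intro h0
  apply hc
  let G : Fin B → F[X] := fun k => ∑ i : Fin A, ∑ j : Fin B, C (c (i, j, k)) * X ^ (i + t * j : ℕ)
  have hAt : B ≠ 0 → A ≤ t := fun hB => (Nat.le_mul_of_pos_right A (by omega)).trans hAB
  have hinj : ∀ (i i' : Fin A) (j j' : Fin B), (i + t * j : ℕ) = i' + t * j' → i = i' ∧ j = j' := by
    intro i i' j j' h
    have hA := hAt (by have := j.2; omega)
    have hi := i.2.trans_le hA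
    have hi' := i'.2.trans_le hA
    have h1 := congrArg (· % t) h
    have h2 := congrArg (· / t) h
    simp only [Nat.add_mul_mod_self_left, Nat.mod_eq_of_lt hi, Nat.mod_eq_of_lt hi'] at h1
    simp only [Nat.add_mul_div_left _ _ (Nat.zero_lt_of_lt hi), Nat.div_eq_of_lt hi,
      Nat.div_eq_of_lt hi', zero_add] at h2
    exact ⟨Fin.ext h1, Fin.ext h2⟩
  have hG : ∀ (i : Fin A) (j k : Fin B), (G k).coeff (i + t * j) = c (i, j, k) := by
    intro i j k
    simp only [G, finsetSum_coeff, coeff_C_mul_X_pow]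
    rw [Finset.sum_eq_single i, Finset.sum_eq_single j]
    · simp
    · intro j' _ hj'
      exact if_neg fun h => hj' (hinj _ _ _ _ h).2.symm
    · simp
    · intro i' _ hi'
      exact Finset.sum_eq_zero fun j' _ => if_neg fun h => hi' (hinj _ _ _ _ h).1.symm
    · simp
  have hsum : ∑ k : Fin B, G k * (X + 1) ^ (t * k : ℕ) = 0 := by
    rw [← h0, stepanovPoly, Fintype.sum_prod_type]
    simp only [Fintype.sum_prod_type, G, Finset.sum_mul]
    rw [Finset.sum_comm]
    refine Finset.sum_congr rfl fun i _ => ?_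
    rw [Finset.sum_comm]
    refine Finset.sum_congr rfl fun j _ => Finset.sum_congr rfl fun k _ => ?_
    rw [smul_eq_C_mul, pow_add]; ring
  have hGzero : ∀ k, G k = 0 := by
    intro k
    induction k using WellFoundedLT.induction with
    | ind k ih =>
    have hB : B ≠ 0 := by have := k.2; omega
    have hdvd : (X + 1 : F[X]) ^ t ∣ G k := by
      have h1 : (X + 1 : F[X]) ^ (t * k : ℕ) * (X + 1) ^ t ∣ (X + 1) ^ (t * k : ℕ) * G k := by
        rw [← Finset.add_sum_erase _ _ (Finset.mem_univ k), add_eq_zero_iff_eq_neg] at hsum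
        rw [mul_comm _ (G k), hsum, dvd_neg, ← pow_add]
        refine Finset.dvd_sum fun k' hk' => ?_
        rcases lt_or_gt_of_ne (Finset.ne_of_mem_erase hk') with h | h
        · rw [ih k' h, zero_mul]; exact dvd_zero _
        · refine Dvd.dvd.mul_left (pow_dvd_pow _ ?_) _
          calc t * (k : ℕ) + t = t * (k + 1) := by ring
            _ ≤ t * k' := Nat.mul_le_mul_left _ h
      exact (mul_dvd_mul_iff_left (pow_ne_zero _ (X_add_C_ne_zero 1))).1 h1
    let S : Finset ℕ := (Finset.univ : Finset (Fin A × Fin B)).image fun v => v.1 + t * v.2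
    have hScard : S.card ≤ t :=
      Finset.card_image_le.trans (by simpa using hAB)
    have hX : (X + 1 : F[X]) = X - C (-1) := by simp
    rw [hX] at hdvd
    refine eq_zero_of_sub_C_pow_card_dvd (p := p) (neg_ne_zero.2 one_ne_zero) S ?_ _ ?_
      ((pow_dvd_pow _ hScard).trans hdvd)
    · intro e he
      obtain ⟨v, -, rfl⟩ := Finset.mem_image.1 he
      have h1 := v.1.2.trans_le (hAt hB)
      have h2 : t * ((v.2 : ℕ) + 1) ≤ t * B := Nat.mul_le_mul_left _ v.2.2
      rw [mul_add] at h2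
      omega
    · intro e he
      simp only [G, finsetSum_coeff, coeff_C_mul_X_pow]
      refine Finset.sum_eq_zero fun i _ => Finset.sum_eq_zero fun j _ => if_neg fun h => he ?_
      exact Finset.mem_image.2 ⟨(i, j), Finset.mem_univ _, h.symm⟩
  ext ⟨i, j, k⟩
  rw [← hG, hGzero]; simp

theorem natDegree_stepanovPoly_le {t A B : ℕ} (hA : A ≤ t) (c : Fin A × Fin B × Fin B → F) :
    (stepanovPoly t c).natDegree ≤ 2 * t * B := by
  refine natDegree_sum_le_of_forall_le _ _ fun v _ => ?_
  have h0 : (X ^ (v.1 : ℕ) * (X ^ (t * v.2.1) * (X + 1) ^ (t * v.2.2)) : F[X]).natDegree ≤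
      v.1 + (t * v.2.1 + t * v.2.2) := by compute_degree
  refine (natDegree_smul_le _ _).trans (h0.trans ?_)
  have h1 : t * ((v.2.1 : ℕ) + 1) ≤ t * B := Nat.mul_le_mul_left _ v.2.1.2
  have h2 : t * ((v.2.2 : ℕ) + 1) ≤ t * B := Nat.mul_le_mul_left _ v.2.2.2
  have h3 := v.1.2
  rw [mul_add] at h1 h2
  rw [mul_assoc]
  omega

theorem eval_weightedDeriv_pow_stepanovPoly {t A B : ℕ} (c : Fin A × Fin B × Fin B → F) (n : ℕ)
    (x : F) :
    ((weightedDeriv F ^ n) (stepanovPoly t c)).eval x =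
      (∑ v, (c v * (x ^ t) ^ (v.2.1 : ℕ) * ((x + 1) ^ t) ^ (v.2.2 : ℕ)) •
        (twistedDeriv F (t * v.2.1) (t * v.2.2) ^ n) (X ^ (v.1 : ℕ))).eval x := by
  rw [stepanovPoly, map_sum, eval_finsetSum, eval_finsetSum]
  refine Finset.sum_congr rfl fun v _ => ?_
  rw [map_smul, weightedDeriv_pow_mul]
  simp only [eval_smul, eval_mul, eval_pow, eval_X, eval_add, eval_one, smul_eq_mul, pow_mul]
  ring

/-- **Stepanov's method**: a bound for the number of `x ≠ 0, -1` such that `(x ^ t, (x + 1) ^ t)`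
lies in a given set of pairs. -/
theorem card_mul_le_of_stepanov {p t A B : ℕ} [CharP F p] (S : Finset (F × F)) (P : Finset F)
    (hP : ∀ x ∈ P, x ≠ 0 ∧ x + 1 ≠ 0 ∧ (x ^ t, (x + 1) ^ t) ∈ S)
    (hSAB : 2 * S.card * A < B ^ 2) (hAB : A * B ≤ t) (htB : t * B ≤ p) :
    P.card * A ≤ 2 * t * B := by
  have hB : 0 < B := Nat.pos_of_ne_zero fun h => by simp [h] at hSAB
  have hAt : A ≤ t := (Nat.le_mul_of_pos_right A hB).trans hAB
  have hAp : A ≤ p := hAt.trans ((Nat.le_mul_of_pos_right t hB).trans htB)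
  rcases Nat.eq_zero_or_pos A with rfl | hA
  · simp
  let L : (Fin A × Fin B × Fin B → F) →ₗ[F] (S × Fin A × Fin (2 * A) → F) :=
    LinearMap.pi fun w => ∑ v, (((w.1 : F × F).1 ^ (v.2.1 : ℕ) * (w.1 : F × F).2 ^ (v.2.2 : ℕ)) *
      ((twistedDeriv F (t * v.2.1) (t * v.2.2) ^ (w.2.1 : ℕ)) (X ^ (v.1 : ℕ))).coeff w.2.2) •
        LinearMap.proj v
  have hker : LinearMap.ker L ≠ ⊥ := by
    apply LinearMap.ker_ne_bot_of_finrank_lt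
    simp only [Module.finrank_fintype_fun_eq_card, Fintype.card_prod, Fintype.card_fin,
      Fintype.card_coe]
    nlinarith
  obtain ⟨c, hc, hc0⟩ := Submodule.exists_mem_ne_zero_of_ne_bot hker
  have hpoly : ∀ w ∈ S, ∀ n < A, (∑ v, (c v * w.1 ^ (v.2.1 : ℕ) * w.2 ^ (v.2.2 : ℕ)) •
      (twistedDeriv F (t * v.2.1) (t * v.2.2) ^ n) (X ^ (v.1 : ℕ))) = 0 := by
    intro w hw n hn
    ext l
    by_cases hl : l < 2 * A
    · have h := congrFun (LinearMap.mem_ker.1 hc) (⟨w, hw⟩, ⟨n, hn⟩, ⟨l, hl⟩)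
      simp only [L, LinearMap.pi_apply, LinearMap.sum_apply, LinearMap.smul_apply,
        LinearMap.proj_apply, smul_eq_mul, Pi.zero_apply] at h
      rw [finsetSum_coeff, coeff_zero, ← h]
      refine Finset.sum_congr rfl fun v _ => ?_
      rw [coeff_smul, smul_eq_mul]; ring
    · rw [coeff_zero]
      apply coeff_eq_zero_of_natDegree_lt
      refine lt_of_le_of_lt (natDegree_sum_le_of_forall_le (n := A + n - 1) _ _ fun v _ => ?_)
        (by omega)
      refine (natDegree_smul_le _ _).trans ((natDegree_twistedDeriv_pow_le _ _ _ _).trans ?_)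
      rw [natDegree_X_pow]
      have := v.1.2
      omega
  have hdvd : ∏ x ∈ P, (X - C x) ^ A ∣ stepanovPoly t c := by
    refine Finset.prod_dvd_of_coprime (fun x _ y _ hxy => ?_) fun x hx => ?_
    · exact (pairwise_coprime_X_sub_C Function.injective_id hxy).pow
    · obtain ⟨h0, h1, hS⟩ := hP x hx
      refine sub_C_pow_dvd_of_weightedDeriv h0 h1 hAp _ fun n hn => ?_
      rw [eval_weightedDeriv_pow_stepanovPoly, hpoly _ hS n hn, eval_zero]
  have hdeg := natDegree_le_of_dvd hdvd (stepanovPoly_ne_zero hAB htB hc0)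
  rw [natDegree_prod _ _ fun x _ => pow_ne_zero _ (X_sub_C_ne_zero x)] at hdeg
  simp only [natDegree_pow, natDegree_X_sub_C, mul_one, Finset.sum_const, smul_eq_mul] at hdeg
  exact hdeg.trans (natDegree_stepanovPoly_le hAt c)

/-- Stepanov's bound with the parameters optimised. -/
theorem card_pow_three_le_of_stepanov {p t : ℕ} [CharP F p] (S : Finset (F × F)) (P : Finset F)
    (hP : ∀ x ∈ P, x ≠ 0 ∧ x + 1 ≠ 0 ∧ (x ^ t, (x + 1) ^ t) ∈ S)
    (hSt : 8 * S.card ≤ t ^ 2) (hSp : 8 * S.card * t ^ 4 ≤ p ^ 3) :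
    P.card ^ 3 ≤ 2 ^ 11 * t ^ 2 * S.card ^ 2 := by
  rcases Nat.eq_zero_or_pos S.card with hS | hS
  · have : P = ∅ := Finset.eq_empty_of_forall_notMem fun x hx => by
      have := (hP x hx).2.2
      rw [Finset.card_eq_zero.1 hS] at this
      simp at this
    simp [this]
  set h := S.card with hh
  obtain ⟨A, hA, hAt, hAmax⟩ : ∃ A, 0 < A ∧ 8 * h * A ^ 3 ≤ t ^ 2 ∧ t ^ 2 < 8 * h * (A + 1) ^ 3 := by
    have hex : ∃ A, t ^ 2 < 8 * h * (A + 1) ^ 3 :=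
      ⟨t ^ 2, by nlinarith [Nat.zero_le ((t ^ 2) ^ 3), Nat.zero_le ((t ^ 2) ^ 2)]⟩
    have hpos : 0 < Nat.find hex := (Nat.find_pos hex).2 (by simpa using hSt)
    refine ⟨Nat.find hex, hpos, ?_, Nat.find_spec hex⟩
    have : ¬ t ^ 2 < 8 * h * (Nat.find hex - 1 + 1) ^ 3 :=
      Nat.find_min hex (Nat.sub_lt hpos one_pos)
    rwa [Nat.sub_add_cancel hpos, not_lt] at this
  obtain ⟨B, hB, hB'⟩ : ∃ B, 2 * h * A < B ^ 2 ∧ B ^ 2 ≤ 8 * h * A := by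
    have hpos : 0 < h * A := Nat.mul_pos hS hA
    refine ⟨Nat.sqrt (2 * h * A) + 1, Nat.lt_succ_sqrt' _, ?_⟩
    have h1 := Nat.sqrt_le' (2 * h * A)
    have h2 : 0 < Nat.sqrt (2 * h * A) := Nat.sqrt_pos.2 (by nlinarith)
    nlinarith
  have hAB : A * B ≤ t := by
    refine le_of_pow_le_pow_left₀ two_ne_zero (Nat.zero_le _) ?_
    calc (A * B) ^ 2 = A ^ 2 * B ^ 2 := by ring
      _ ≤ A ^ 2 * (8 * h * A) := by gcongr
      _ = 8 * h * A ^ 3 := by ring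
      _ ≤ t ^ 2 := hAt
  have htB : t * B ≤ p := by
    refine le_of_pow_le_pow_left₀ (n := 6) (by norm_num) (Nat.zero_le _) ?_
    calc (t * B) ^ 6 = t ^ 6 * (B ^ 2) ^ 3 := by ring
      _ ≤ t ^ 6 * (8 * h * A) ^ 3 := by gcongr
      _ = 64 * h ^ 2 * t ^ 6 * (8 * h * A ^ 3) := by ring
      _ ≤ 64 * h ^ 2 * t ^ 6 * t ^ 2 := by gcongr
      _ = (8 * h * t ^ 4) ^ 2 := by ring
      _ ≤ (p ^ 3) ^ 2 := by gcongr
      _ = p ^ 6 := by ring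
  have hM := card_mul_le_of_stepanov (A := A) (B := B) S P hP hB hAB htB
  set M := P.card
  have ht : 0 < t := (Nat.mul_pos hA (Nat.pos_of_ne_zero fun h => by simp [h] at hB)).trans_le hAB
  have h1 : M ^ 2 * A ≤ 32 * t ^ 2 * h := by
    refine le_of_mul_le_mul_right ?_ hA
    calc M ^ 2 * A * A = (M * A) ^ 2 := by ring
      _ ≤ (2 * t * B) ^ 2 := by gcongr
      _ = 4 * t ^ 2 * B ^ 2 := by ring
      _ ≤ 4 * t ^ 2 * (8 * h * A) := by gcongr
      _ = 32 * t ^ 2 * h * A := by ring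
  have h2 : t ^ 2 ≤ 64 * h * A ^ 3 := by
    calc t ^ 2 ≤ 8 * h * (A + 1) ^ 3 := hAmax.le
      _ ≤ 8 * h * (A + A) ^ 3 := by gcongr; exact hA
      _ = 64 * h * A ^ 3 := by ring
  have h3 : (M ^ 3) ^ 2 ≤ (2 ^ 11 * t ^ 2 * h ^ 2) ^ 2 := by
    refine le_of_mul_le_mul_right ?_ (pow_pos ht 2)
    calc (M ^ 3) ^ 2 * t ^ 2 ≤ (M ^ 3) ^ 2 * (64 * h * A ^ 3) := by gcongr
      _ = 64 * h * (M ^ 2 * A) ^ 3 := by ring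
      _ ≤ 64 * h * (32 * t ^ 2 * h) ^ 3 := by gcongr
      _ = 2 ^ 21 * (h ^ 4 * t ^ 4 * t ^ 2) := by ring
      _ ≤ 2 ^ 22 * (h ^ 4 * t ^ 4 * t ^ 2) := by gcongr <;> norm_num
      _ = (2 ^ 11 * t ^ 2 * h ^ 2) ^ 2 * t ^ 2 := by ring
  exact le_of_pow_le_pow_left₀ two_ne_zero (Nat.zero_le _) h3

end Stepanov

/-- A finite set `G` closed under multiplication and not containing `0` consists of
`|G|`-th roots of unity. -/
theorem pow_card_eq_one_of_mul_mem {F : Type*} [Field F] {G : Finset F} (h0 : (0 : F) ∉ G)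
    (hmul : ∀ x ∈ G, ∀ y ∈ G, x * y ∈ G) {x : F} (hx : x ∈ G) : x ^ G.card = 1 := by
  classical
  have hne : ∀ y ∈ G, y ≠ 0 := fun y hy h => h0 (h ▸ hy)
  have hinj : Function.Injective (x * ·) := mul_right_injective₀ (hne x hx)
  have himg : G.image (x * ·) = G :=
    Finset.eq_of_subset_of_card_le
      (Finset.image_subset_iff.2 fun y hy => hmul x hx y hy)
      (Finset.card_image_of_injective G hinj).ge
  have hprod : ∏ y ∈ G, y = x ^ G.card * ∏ y ∈ G, y := by
    conv_lhs => rw [← himg]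
    rw [Finset.prod_image hinj.injOn, Finset.prod_mul_distrib, Finset.prod_const]
  exact (mul_eq_right₀ (Finset.prod_ne_zero_iff.2 hne)).1 hprod.symm

/-- A `G`-invariant set `Q` has at most `|Q| / |G|` distinct `|G|`-th powers. -/
theorem card_image_pow_mul_card_le {F : Type*} [Field F] [DecidableEq F] {G Q : Finset F}
    (h0 : (0 : F) ∉ G) (hmul : ∀ x ∈ G, ∀ y ∈ G, x * y ∈ G) (hQ0 : (0 : F) ∉ Q)
    (hQ : ∀ q ∈ Q, ∀ g ∈ G, q * g ∈ Q) :
    (Q.image (· ^ G.card)).card * G.card ≤ Q.card := by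
  rw [mul_comm]
  refine Finset.mul_card_image_le_card _ _ fun b hb => ?_
  obtain ⟨q, hq, rfl⟩ := Finset.mem_image.1 hb
  have hq0 : q ≠ 0 := fun h => hQ0 (h ▸ hq)
  refine Finset.card_le_card_of_injOn (q * ·) (fun g hg => ?_) (mul_right_injective₀ hq0).injOn
  simp only [Finset.coe_filter, Set.mem_ofPred_eq]
  exact ⟨hQ q hq g hg, by rw [mul_pow, pow_card_eq_one_of_mul_mem h0 hmul hg, mul_one]⟩

theorem sum_convAB_le_card_mul {p : ℕ} [Fact p.Prime] {G Q Q₁ : Finset (ZMod p)}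
    (h0 : (0 : ZMod p) ∉ G) (hinv : ∀ x ∈ G, x⁻¹ ∈ G)
    (hQ : ∀ q ∈ Q, ∀ g ∈ G, q * g ∈ Q) (hQ₁ : ∀ q ∈ Q₁, ∀ g ∈ G, q * g ∈ Q₁) :
    ∑ x ∈ G, convAB Q Q₁ x ≤ G.card * convAB Q Q₁ 1 := by
  rw [← smul_eq_mul]
  refine Finset.sum_le_card_nsmul _ _ _ fun g hg => ?_
  have hg0 : g ≠ 0 := fun h => h0 (h ▸ hg)
  refine Finset.card_le_card_of_injOn (· * g⁻¹) (fun y hy => ?_)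
    (mul_left_injective₀ (inv_ne_zero hg0)).injOn
  simp only [Finset.coe_filter, Set.mem_ofPred_eq] at hy ⊢
  refine ⟨hQ _ hy.1 _ (hinv g hg), ?_⟩
  rw [show y * g⁻¹ + 1 = (y + g) * g⁻¹ by field_simp]
  exact hQ₁ _ hy.2 _ (hinv g hg)

/-- There exist absolute constants `c, C > 0` such that for every prime `p`,
every multiplicative subgroup `Γ ⊆ F_p^*`, and all `Γ`-invariant sets `Q, Q₁ ⊆ F_p^*` with
`|Q||Q₁| ≤ c|Γ|⁴` and `|Q||Q₁||Γ|² ≤ c p³`, one has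
`Σ_{x ∈ Γ} (Q ∘ Q₁)(x) ≤ C · |Γ|^{1/3} · |Q|^{2/3} · |Q₁|^{2/3}`. -/
theorem stmt3 :
    ∃ c C : ℝ, 0 < c ∧ 0 < C ∧
      ∀ (p : ℕ) [Fact p.Prime], ∀ Γ Q Q₁ : Finset (ZMod p),
        (0 : ZMod p) ∉ Γ → (1 : ZMod p) ∈ Γ →
        (∀ x ∈ Γ, ∀ y ∈ Γ, x * y ∈ Γ) → (∀ x ∈ Γ, x⁻¹ ∈ Γ) →
        (0 : ZMod p) ∉ Q → (∀ q ∈ Q, ∀ γ ∈ Γ, q * γ ∈ Q) →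
        (0 : ZMod p) ∉ Q₁ → (∀ q ∈ Q₁, ∀ γ ∈ Γ, q * γ ∈ Q₁) →
        (Q.card : ℝ) * (Q₁.card : ℝ) ≤ c * (Γ.card : ℝ) ^ (4 : ℕ) →
        (Q.card : ℝ) * (Q₁.card : ℝ) * (Γ.card : ℝ) ^ (2 : ℕ) ≤ c * (p : ℝ) ^ (3 : ℕ) →
        (∑ x ∈ Γ, (convAB Q Q₁ x : ℝ)) ≤
          C * (Γ.card : ℝ) ^ ((1 : ℝ) / 3) * (Q.card : ℝ) ^ ((2 : ℝ) / 3) *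
            (Q₁.card : ℝ) ^ ((2 : ℝ) / 3) := by
  refine ⟨1 / 8, 16, by norm_num, by norm_num, ?_⟩
  intro p _ G Q Q₁ h0 h1 hmul hinv hQ0 hQ hQ₁0 hQ₁ hc hc'
  have hcN : 8 * (Q.card * Q₁.card) ≤ G.card ^ 4 := by
    have : 8 * ((Q.card : ℝ) * Q₁.card) ≤ (G.card : ℝ) ^ 4 := by linarith
    exact_mod_cast this
  have hcN' : 8 * (Q.card * Q₁.card * G.card ^ 2) ≤ p ^ 3 := by
    have : 8 * ((Q.card : ℝ) * Q₁.card * (G.card : ℝ) ^ 2) ≤ (p : ℝ) ^ 3 := by linarith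
    exact_mod_cast this
  have ht : 0 < G.card := Finset.card_pos.2 ⟨1, h1⟩
  have ha := card_image_pow_mul_card_le h0 hmul hQ0 hQ
  have hb := card_image_pow_mul_card_le h0 hmul hQ₁0 hQ₁
  have hsum := sum_convAB_le_card_mul h0 hinv hQ hQ₁
  let S := Q.image (· ^ G.card) ×ˢ Q₁.image (· ^ G.card)
  have hS : S.card * G.card ^ 2 ≤ Q.card * Q₁.card := by
    calc S.card * G.card ^ 2
        = ((Q.image (· ^ G.card)).card * G.card) * ((Q₁.image (· ^ G.card)).card * G.card) := by
          rw [Finset.card_product]; ring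
      _ ≤ Q.card * Q₁.card := Nat.mul_le_mul ha hb
  have hM : convAB Q Q₁ 1 ^ 3 ≤ 2 ^ 11 * G.card ^ 2 * S.card ^ 2 := by
    refine card_pow_three_le_of_stepanov (p := p) S _ (fun x hx => ?_) ?_ ?_
    · obtain ⟨hx, hx'⟩ := Finset.mem_filter.1 hx
      exact ⟨fun h => hQ0 (h ▸ hx), fun h => hQ₁0 (h ▸ hx'),
        Finset.mem_product.2 ⟨Finset.mem_image_of_mem _ hx, Finset.mem_image_of_mem _ hx'⟩⟩
    · refine le_of_mul_le_mul_right ?_ (pow_pos ht 2)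
      calc 8 * S.card * G.card ^ 2 = 8 * (S.card * G.card ^ 2) := by ring
        _ ≤ 8 * (Q.card * Q₁.card) := by gcongr
        _ ≤ G.card ^ 4 := hcN
        _ = G.card ^ 2 * G.card ^ 2 := by ring
    · calc 8 * S.card * G.card ^ 4 = 8 * (S.card * G.card ^ 2 * G.card ^ 2) := by ring
        _ ≤ 8 * (Q.card * Q₁.card * G.card ^ 2) := by gcongr
        _ ≤ p ^ 3 := hcN'
  have hN : (∑ x ∈ G, convAB Q Q₁ x) ^ 3 ≤ 16 ^ 3 * G.card * (Q.card * Q₁.card) ^ 2 := by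
    calc (∑ x ∈ G, convAB Q Q₁ x) ^ 3 ≤ (G.card * convAB Q Q₁ 1) ^ 3 := by gcongr
      _ = G.card ^ 3 * convAB Q Q₁ 1 ^ 3 := by ring
      _ ≤ G.card ^ 3 * (2 ^ 11 * G.card ^ 2 * S.card ^ 2) := by gcongr
      _ = 2 ^ 11 * G.card * (S.card * G.card ^ 2) ^ 2 := by ring
      _ ≤ 16 ^ 3 * G.card * (Q.card * Q₁.card) ^ 2 := by
        gcongr ?_ * _ * ?_ ^ 2
        norm_num
  have hN' : (∑ x ∈ G, (convAB Q Q₁ x : ℝ)) ^ 3 ≤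
      16 ^ 3 * (G.card : ℝ) * ((Q.card : ℝ) * Q₁.card) ^ 2 := by exact_mod_cast hN
  have hcube : ∀ (n : ℕ) (r : ℝ), ((n : ℝ) ^ (r / 3)) ^ 3 = (n : ℝ) ^ r := fun n r => by
    rw [← Real.rpow_natCast, ← Real.rpow_mul n.cast_nonneg]
    norm_num
  refine le_of_pow_le_pow_left₀ three_ne_zero (by positivity) (hN'.trans_eq ?_)
  simp only [mul_pow, hcube, Real.rpow_one, Real.rpow_two]
  ring
end

section
/- There is an absolute constant C > 0 such that for every prime p and every multiplicative subgroup Γ of F_p^* with 2 ≤ |Γ| ≤ p^{2/3}, one has E₃(Γ) ≤ C · |Γ|^3 · log |Γ|. -/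
open Finset

/-- `(A ∘ A)(x)` = number of pairs `(a, a') ∈ A × A` with `a' - a = x`. -/
def convAA {p : ℕ} (A : Finset (ZMod p)) (x : ZMod p) : ℕ :=
  (A.filter fun a => a + x ∈ A).card

/-- Third energy `E₃(A) = Σ_x (A ∘ A)(x)³`. -/
def energy3 {p : ℕ} [NeZero p] (A : Finset (ZMod p)) : ℕ :=
  ∑ x : ZMod p, (convAA A x) ^ 3

section QDeriv
open Polynomial
variable {K : Type*} [Field K]

/-- The differential operator sending `f` to `q` times its derivative. -/
noncomputable def mulDerivative (q : K[X]) : K[X] →ₗ[K] K[X] :=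
  (LinearMap.mulLeft K q).comp derivative

theorem mulDerivative_apply (q f : K[X]) : mulDerivative q f = q * derivative f := rfl

theorem X_sub_C_pow_dvd_of_iterate_mulDerivative {q : K[X]} {y : K} (hq : q.eval y ≠ 0) (D : ℕ)
    (hD : ∀ m : ℕ, 0 < m → m < D → (m : K) ≠ 0) (f : K[X])
    (hf : ∀ n < D, ((mulDerivative q)^[n] f).eval y = 0) : (X - C y) ^ D ∣ f := by
  induction D generalizing f with
  | zero => simp
  | succ D ih =>
    have h1 : (X - C y) ^ D ∣ q * derivative f :=
      ih (fun m h0 h => hD m h0 (by omega)) (mulDerivative q f) fun n hn => by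
        have := hf (n + 1) (by omega)
        rwa [Function.iterate_succ_apply] at this
    have hcop : IsCoprime ((X - C y) ^ D) q := by
      apply IsCoprime.pow_left
      rw [(irreducible_X_sub_C y).coprime_iff_not_dvd, dvd_iff_isRoot]
      exact hq
    have h2 : (X - C y) ^ D ∣ derivative f := hcop.dvd_of_dvd_mul_left h1
    have h0 : f.eval y = 0 := hf 0 (by omega)
    rcases eq_or_ne f 0 with rfl | hne
    · simp
    obtain ⟨g, hg, hndvd⟩ := exists_eq_pow_rootMultiplicity_mul_and_not_dvd f hne y
    have hm : 0 < rootMultiplicity y f := (rootMultiplicity_pos hne).2 h0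
    generalize rootMultiplicity y f = m at hg hm
    obtain ⟨m, rfl⟩ : ∃ k, m = k + 1 := ⟨m - 1, by omega⟩
    by_cases hlt : D + 1 ≤ m + 1
    · exact (pow_dvd_pow _ hlt).trans ⟨g, hg⟩
    exfalso
    have h3 : (X - C y) ^ (m + 1) ∣ derivative f := (pow_dvd_pow _ (by omega)).trans h2
    have h4 : derivative f =
        (X - C y) ^ m * (((m + 1 : ℕ) : K[X]) * g + (X - C y) * derivative g) := by
      rw [hg, derivative_mul, derivative_X_sub_C_pow]
      simp
      ring
    rw [h4, pow_succ] at h3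
    have h5 := (mul_dvd_mul_iff_left (pow_ne_zero m (X_sub_C_ne_zero y))).1 h3
    have h6 := (dvd_add_left (dvd_mul_right _ _)).1 h5
    rw [dvd_iff_isRoot] at h6 hndvd
    simp only [IsRoot.def, eval_mul, eval_natCast, mul_eq_zero] at h6 hndvd
    exact h6.elim (hD (m + 1) (by omega) (by omega)) hndvd

theorem eval_iterate_mulDerivative_eq_zero (q : K[X]) (y : K) (n : ℕ) (f : K[X])
    (hf : (X - C y) ^ (n + 1) ∣ f) : ((mulDerivative q)^[n] f).eval y = 0 := by
  induction n generalizing f with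
  | zero => simpa [dvd_iff_isRoot] using hf
  | succ n ih =>
    rw [Function.iterate_succ_apply]
    apply ih
    obtain ⟨g, rfl⟩ := hf
    rw [mulDerivative_apply, derivative_mul, derivative_X_sub_C_pow]
    refine Dvd.dvd.mul_left (dvd_add ?_ ?_) _
    · exact Dvd.dvd.mul_right (Dvd.dvd.mul_left (by simp) _) _
    · exact Dvd.dvd.mul_right (pow_dvd_pow _ (by omega)) _

theorem iterate_mulDerivative_sum {ι : Type*} (s : Finset ι) (q : K[X]) (g : ι → K) (F : ι → K[X])
    (n : ℕ) : (mulDerivative q)^[n] (∑ i ∈ s, C (g i) * F i) =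
      ∑ i ∈ s, C (g i) * (mulDerivative q)^[n] (F i) := by
  simp only [← Module.End.pow_apply, map_sum, ← smul_eq_C_mul, map_smul]

theorem X_mul_derivative_X_pow (m : ℕ) :
    X * derivative ((X : K[X]) ^ m) = (m : K[X]) * X ^ m := by
  cases m with
  | zero => simp
  | succ m => rw [derivative_X_pow, C_eq_natCast, Nat.add_sub_cancel, pow_succ]; ring

theorem iterate_mulDerivative_X_pow (n e : ℕ) :
    (mulDerivative (X : K[X]))^[n] (X ^ e) = C ((e : K) ^ n) * X ^ e := by
  induction n with
  | zero => simp
  | succ n ih =>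
    rw [Function.iterate_succ_apply', ih, mulDerivative_apply]
    rw [derivative_C_mul, mul_left_comm, X_mul_derivative_X_pow, pow_succ, C_mul]
    simp
    ring

/-- A polynomial with at most `m` monomials, whose exponents are distinct in `K`, cannot vanish to
order `m` at `1` unless it is zero. -/
theorem eq_zero_of_X_sub_one_pow_dvd_sum {ι : Type*} [Fintype ι] (e : ι → ℕ)
    (he : Function.Injective fun i => (e i : K)) (g : ι → K) {m : ℕ} (hm : Fintype.card ι ≤ m)
    (h : (X - C 1) ^ m ∣ ∑ i, C (g i) * X ^ e i) (i : ι) : g i = 0 := by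
  classical
  have hpow (n : ℕ) (hn : n < Fintype.card ι) : ∑ i, g i * (e i : K) ^ n = 0 := by
    have := eval_iterate_mulDerivative_eq_zero X 1 n _ ((pow_dvd_pow _ (by omega)).trans h)
    rw [iterate_mulDerivative_sum, eval_finsetSum] at this
    simpa [iterate_mulDerivative_X_pow] using this
  have hpoly (P : K[X]) (hP : P.natDegree < Fintype.card ι) :
      ∑ i, g i * P.eval (e i : K) = 0 := by
    simp_rw [eval_eq_sum_range' hP, Finset.mul_sum]
    rw [Finset.sum_comm]
    refine Finset.sum_eq_zero fun n hn => ?_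
    have := hpow n (Finset.mem_range.1 hn)
    rw [← mul_zero (P.coeff n), ← this, Finset.mul_sum]
    exact Finset.sum_congr rfl fun _ _ => by ring
  have hcard : 0 < Fintype.card ι := Fintype.card_pos_iff.2 ⟨i⟩
  have key := hpoly (∏ j ∈ univ.erase i, (X - C (e j : K))) (by
    rw [natDegree_finsetProd_X_sub_C_eq_card, card_erase_of_mem (mem_univ i), card_univ]
    omega)
  rw [Finset.sum_eq_single i] at key
  · rcases mul_eq_zero.1 key with h0 | h0
    · exact h0
    · rw [eval_prod, Finset.prod_eq_zero_iff] at h0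
      obtain ⟨j, hj, h0⟩ := h0
      simp only [eval_sub, eval_X, eval_C, sub_eq_zero] at h0
      exact absurd (he h0).symm (Finset.ne_of_mem_erase hj)
  · intro j _ hj
    rw [eval_prod, Finset.prod_eq_zero (Finset.mem_erase.2 ⟨hj, mem_univ j⟩) (by simp), mul_zero]
  · simp

theorem eq_zero_of_sum_X_pow_mul_X_sub_one_pow_eq_zero {ι : Type*} [Fintype ι] (e : ι → ℕ)
    (he : Function.Injective fun i => (e i : K)) {t B : ℕ} (ht : Fintype.card ι ≤ t)
    (φ : ι × Fin B → K)
    (h : ∑ z : ι × Fin B, C (φ z) * (X ^ e z.1 * (X - C 1) ^ (t * (z.2 : ℕ))) = 0) : φ = 0 := by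
  suffices H : ∀ b (hb : b < B) (i : ι), φ (i, ⟨b, hb⟩) = 0 by
    ext ⟨i, b⟩
    exact H b b.2 i
  intro b
  induction b using Nat.strong_induction_on with
  | _ b ih =>
  intro hb
  apply eq_zero_of_X_sub_one_pow_dvd_sum e he _ ht
  rw [Fintype.sum_prod_type_right, ← Finset.add_sum_erase _ _ (mem_univ (⟨b, hb⟩ : Fin B))] at h
  have hrest : (X - C (1 : K)) ^ (t * b + t) ∣ ∑ b' ∈ univ.erase (⟨b, hb⟩ : Fin B),
      ∑ i, C (φ (i, b')) * (X ^ e i * (X - C 1) ^ (t * (b' : ℕ))) := by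
    refine Finset.dvd_sum fun b' hb' => Finset.dvd_sum fun i _ => ?_
    rcases lt_trichotomy (b' : ℕ) b with hlt | heq | hgt
    · rw [ih b' hlt b'.2 i]
      simp
    · exact absurd (Fin.ext heq) (Finset.ne_of_mem_erase hb')
    · refine Dvd.dvd.mul_left (Dvd.dvd.mul_left (pow_dvd_pow _ ?_) _) _
      nlinarith
  have h1 : (X - C (1 : K)) ^ (t * b + t) ∣
      ∑ i, C (φ (i, ⟨b, hb⟩)) * (X ^ e i * (X - C 1) ^ (t * b)) :=
    (dvd_add_left hrest).1 (h ▸ dvd_zero _)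
  have h2 : ∑ i, C (φ (i, ⟨b, hb⟩)) * (X ^ e i * (X - C 1) ^ (t * b)) =
      (X - C 1) ^ (t * b) * ∑ i, C (φ (i, ⟨b, hb⟩)) * X ^ e i := by
    rw [Finset.mul_sum]
    exact Finset.sum_congr rfl fun _ _ => by ring
  rw [h2, pow_add] at h1
  exact (mul_dvd_mul_iff_left (pow_ne_zero _ (X_sub_C_ne_zero 1))).1 h1

/-- The operator that `X (X - 1) d/dX` induces on the cofactor of `X ^ m * (X - 1) ^ n`. -/
noncomputable def twistedDerivative (m n : ℕ) (f : K[X]) : K[X] :=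
  X * (X - C 1) * derivative f + ((m : K[X]) * (X - C 1) + (n : K[X]) * X) * f

theorem mulDerivative_X_pow_mul_X_sub_one_pow_mul (m n : ℕ) (f : K[X]) :
    mulDerivative (X * (X - C 1)) (X ^ m * (X - C 1) ^ n * f) =
      X ^ m * (X - C 1) ^ n * twistedDerivative m n f := by
  have h1 := X_mul_derivative_X_pow (K := K) m
  have h2 : (X - C 1) * derivative ((X - C (1 : K)) ^ n) = (n : K[X]) * (X - C 1) ^ n := by
    cases n with
    | zero => simp
    | succ n => rw [derivative_X_sub_C_pow, C_eq_natCast, Nat.add_sub_cancel, pow_succ]; ring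
  rw [mulDerivative_apply, derivative_mul, derivative_mul, twistedDerivative]
  linear_combination (X - C 1) * (X - C 1) ^ n * f * h1 + X * X ^ m * f * h2

theorem iterate_mulDerivative_X_pow_mul_X_sub_one_pow_mul (m n k : ℕ) (f : K[X]) :
    (mulDerivative (X * (X - C 1)))^[k] (X ^ m * (X - C 1) ^ n * f) =
      X ^ m * (X - C 1) ^ n * (twistedDerivative m n)^[k] f := by
  induction k generalizing f with
  | zero => rfl
  | succ k ih =>
    rw [Function.iterate_succ_apply, Function.iterate_succ_apply,
      mulDerivative_X_pow_mul_X_sub_one_pow_mul, ih]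

theorem natDegree_twistedDerivative_le {d : ℕ} (m n : ℕ) (f : K[X]) (hf : f.natDegree ≤ d) :
    (twistedDerivative m n f).natDegree ≤ d + 1 := by
  rw [twistedDerivative]
  have hX : (X : K[X]).natDegree ≤ 1 := natDegree_X_le
  have hX1 : (X - C (1 : K)).natDegree ≤ 1 := natDegree_X_sub_C_le _
  refine natDegree_add_le_of_degree_le ?_ ?_
  · rcases Nat.eq_zero_or_pos f.natDegree with h0 | h0
    · rw [natDegree_eq_zero] at h0
      obtain ⟨c, rfl⟩ := h0
      simp
    · have h1 := natDegree_derivative_lt h0.ne'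
      have h2 := natDegree_mul_le_of_le (natDegree_mul_le_of_le hX hX1) h1.le
      have h3 := natDegree_mul_le_of_le (natDegree_mul_le_of_le hX hX1)
        (show (derivative f).natDegree ≤ f.natDegree - 1 by omega)
      omega
  · have h1 : ((m : K[X]) * (X - C 1) + (n : K[X]) * X).natDegree ≤ 1 := by
      refine natDegree_add_le_of_degree_le ?_ ?_
      · exact (natDegree_mul_le_of_le (natDegree_natCast m).le hX1).trans (by omega)
      · exact (natDegree_mul_le_of_le (natDegree_natCast n).le hX).trans (by omega)
    exact (natDegree_mul_le_of_le h1 hf).trans (by omega)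

theorem natDegree_iterate_twistedDerivative_X_pow_le (m n a k : ℕ) :
    ((twistedDerivative m n)^[k] (X ^ a : K[X])).natDegree ≤ a + k := by
  induction k with
  | zero => simp
  | succ k ih =>
    rw [Function.iterate_succ_apply']
    exact natDegree_twistedDerivative_le m n _ ih

end QDeriv

section Stepanov
open Polynomial
variable {K : Type*} [Field K]

/-- The coefficients of the combinations of twisted derivatives which have to vanish in order that
the auxiliary polynomial with coefficients `φ` vanishes to order `A` at every `y` with
`y ^ t = (y - 1) ^ t ∈ Λ`. -/
noncomputable def stepanovConditions (Λ : Finset K) (t A B : ℕ) :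
    ((Fin A × Fin B) × Fin B → K) →ₗ[K] (Λ × Fin A × Fin (2 * A) → K) where
  toFun φ w := ∑ z, φ z * ((w.1 : K) ^ ((z.1.2 : ℕ) + (z.2 : ℕ)) *
    ((twistedDerivative (t * z.1.2) (t * z.2))^[(w.2.1 : ℕ)]
      (X ^ (z.1.1 : ℕ) : K[X])).coeff w.2.2)
  map_add' φ ψ := by
    ext w
    simp [add_mul, Finset.sum_add_distrib]
  map_smul' c φ := by
    ext w
    simp [Finset.mul_sum, mul_assoc]

theorem exists_ne_zero_stepanovConditions_eq_zero (Λ : Finset K) {t A B : ℕ} (hA : 0 < A)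
    (h : 2 * #Λ * A < B ^ 2) : ∃ φ, φ ≠ 0 ∧ stepanovConditions Λ t A B φ = 0 := by
  have hker : LinearMap.ker (stepanovConditions Λ t A B) ≠ ⊥ := by
    apply LinearMap.ker_ne_bot_of_finrank_lt
    simp only [Module.finrank_fintype_fun_eq_card, Fintype.card_prod, Fintype.card_fin,
      Fintype.card_coe]
    nlinarith [Nat.mul_lt_mul_of_pos_left h hA]
  obtain ⟨φ, hφ, hne⟩ := Submodule.exists_mem_ne_zero_of_ne_bot hker
  exact ⟨φ, hne, hφ⟩

theorem mul_card_le_of_forall_pow_eq {p : ℕ} [Fact p.Prime] [CharP K p] (Λ S : Finset K)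
    {t A B : ℕ} (hA : 0 < A) (ht : 0 < t) (hΛ : 2 * #Λ * A < B ^ 2) (hAB : A * B ≤ t)
    (htB : t * B ≤ p) (hS : ∀ y ∈ S, y ^ t ∈ Λ ∧ (y - 1) ^ t = y ^ t) :
    A * #S ≤ 2 * t * B := by
  have hB : 0 < B := Nat.pos_of_ne_zero fun h => by simp [h] at hΛ
  have hAt : A ≤ t := le_trans (Nat.le_mul_of_pos_right A hB) hAB
  have htp : t ≤ p := le_trans (Nat.le_mul_of_pos_right t hB) htB
  have hcast {m n : ℕ} (hm : m < p) (hn : n < p) (h : (m : K) = n) : m = n :=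
    Nat.ModEq.eq_of_lt_of_lt ((CharP.natCast_eq_natCast K p).1 h) hm hn
  obtain ⟨φ, hne, hφ⟩ := exists_ne_zero_stepanovConditions_eq_zero (t := t) Λ hA hΛ
  let e : Fin A × Fin B → ℕ := fun i => i.1 + t * i.2
  have he_lt (i : Fin A × Fin B) : e i < t * B := by
    have h1 := i.1.2
    have h2 : t * ((i.2 : ℕ) + 1) ≤ t * B := Nat.mul_le_mul_left t i.2.2
    simp only [e]
    linarith
  have he : Function.Injective fun i => (e i : K) := by
    intro i j hij
    have h := hcast ((he_lt i).trans_le htB) ((he_lt j).trans_le htB) hij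
    simp only [e] at h
    have hi : (i.1 : ℕ) < t := i.1.2.trans_le hAt
    have hj : (j.1 : ℕ) < t := j.1.2.trans_le hAt
    have h1 := congrArg (· % t) h
    have h2 := congrArg (· / t) h
    simp only [Nat.add_mul_mod_self_left, Nat.mod_eq_of_lt hi, Nat.mod_eq_of_lt hj] at h1
    simp only [Nat.add_mul_div_left _ _ ht, Nat.div_eq_of_lt hi, Nat.div_eq_of_lt hj,
      zero_add] at h2
    exact Prod.ext (Fin.ext h1) (Fin.ext h2)
  set Ψ : K[X] := ∑ z : (Fin A × Fin B) × Fin B,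
    C (φ z) * (X ^ e z.1 * (X - C 1) ^ (t * (z.2 : ℕ))) with hΨ
  have hΨ0 : Ψ ≠ 0 := fun h0 =>
    hne (eq_zero_of_sum_X_pow_mul_X_sub_one_pow_eq_zero e he (by simpa using hAB) φ h0)
  have hdeg : Ψ.natDegree ≤ 2 * t * B := by
    refine natDegree_sum_le_of_forall_le _ _ fun z _ => ?_
    refine (natDegree_C_mul_le _ _).trans ?_
    refine (natDegree_mul_le_of_le (natDegree_X_pow_le _)
      (natDegree_pow_le_of_le _ (natDegree_X_sub_C_le _))).trans ?_
    have h1 := he_lt z.1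
    have h2 : t * (z.2 : ℕ) ≤ t * B := Nat.mul_le_mul_left t z.2.2.le
    linarith
  have hdvd (y : K) (hy : y ∈ S) : (X - C y) ^ A ∣ Ψ := by
    obtain ⟨hyΛ, hy1⟩ := hS y hy
    have hy0 : y ≠ 0 := by
      rintro rfl
      rw [zero_pow ht.ne'] at hy1
      have := (pow_eq_zero_iff ht.ne').1 hy1
      simp at this
    have hy10 : y - 1 ≠ 0 := fun h0 => by
      rw [h0, zero_pow ht.ne'] at hy1
      exact hy0 (pow_eq_zero_iff ht.ne' |>.1 hy1.symm)
    refine X_sub_C_pow_dvd_of_iterate_mulDerivative (q := X * (X - C 1)) (by simp [hy0, hy10]) A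
      (fun m h0 hm h => h0.ne' (hcast (by omega) (by omega) (by simpa using h))) Ψ
      fun n hn => ?_
    have hterm (z : (Fin A × Fin B) × Fin B) :
        ((mulDerivative (X * (X - C 1)))^[n]
          (X ^ e z.1 * (X - C (1 : K)) ^ (t * (z.2 : ℕ)))).eval y =
        ∑ k : Fin (2 * A), y ^ (k : ℕ) * ((y ^ t) ^ ((z.1.2 : ℕ) + (z.2 : ℕ)) *
          ((twistedDerivative (t * z.1.2) (t * z.2))^[n] (X ^ (z.1.1 : ℕ) : K[X])).coeff k) := by
      have h1 : X ^ e z.1 * (X - C (1 : K)) ^ (t * (z.2 : ℕ)) =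
          X ^ (t * (z.1.2 : ℕ)) * (X - C 1) ^ (t * (z.2 : ℕ)) * X ^ (z.1.1 : ℕ) := by
        simp only [e, pow_add]
        ring
      have hlt : ((twistedDerivative (t * z.1.2) (t * z.2))^[n]
          (X ^ (z.1.1 : ℕ) : K[X])).natDegree < 2 * A := by
        have := natDegree_iterate_twistedDerivative_X_pow_le (K := K) (t * z.1.2) (t * z.2) z.1.1 n
        have := z.1.1.2
        omega
      rw [h1, iterate_mulDerivative_X_pow_mul_X_sub_one_pow_mul, eval_mul,
        eval_eq_sum_range' hlt, ← Fin.sum_univ_eq_sum_range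
          (fun k => coeff _ k * y ^ k), Finset.mul_sum]
      refine Finset.sum_congr rfl fun k _ => ?_
      simp only [eval_mul, eval_pow, eval_X, eval_sub, eval_C, pow_mul, hy1]
      ring
    rw [hΨ, iterate_mulDerivative_sum, eval_finsetSum]
    simp_rw [eval_mul, eval_C, hterm, Finset.mul_sum]
    rw [Finset.sum_comm]
    refine Finset.sum_eq_zero fun k _ => ?_
    have h1 : ∑ z, φ z * ((y ^ t) ^ ((z.1.2 : ℕ) + (z.2 : ℕ)) *
        ((twistedDerivative (t * z.1.2) (t * z.2))^[n] (X ^ (z.1.1 : ℕ) : K[X])).coeff k) = 0 :=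
      congrFun hφ (⟨y ^ t, hyΛ⟩, ⟨n, hn⟩, k)
    rw [← mul_zero (y ^ (k : ℕ)), ← h1, Finset.mul_sum]
    exact Finset.sum_congr rfl fun _ _ => by ring
  have hprod : ∏ y ∈ S, (X - C y) ^ A ∣ Ψ := by
    refine Finset.prod_dvd_of_coprime (fun x _ y _ hxy => ?_) hdvd
    exact (pairwise_coprime_X_sub_C Function.injective_id hxy).pow
  have h := natDegree_le_of_dvd hprod hΨ0
  rw [natDegree_prod_of_monic _ _ fun y _ => (monic_X_sub_C y).pow A] at h
  simp only [natDegree_pow, natDegree_X_sub_C, mul_one, Finset.sum_const, smul_eq_mul] at h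
  linarith

end Stepanov

section Energy

theorem sum_convAA {p : ℕ} [NeZero p] (A : Finset (ZMod p)) : ∑ x, convAA A x = #A ^ 2 := by
  simp_rw [convAA, card_filter]
  rw [Finset.sum_comm]
  have h (a : ZMod p) : ∑ x, (if a + x ∈ A then 1 else 0) = #A := by
    rw [Fintype.sum_equiv (Equiv.addLeft a) (fun x => if a + x ∈ A then 1 else 0)
      (fun x => if x ∈ A then 1 else 0) fun _ => rfl]
    simp
  simp [h, sq]

theorem convAA_le_card {p : ℕ} (A : Finset (ZMod p)) (x : ZMod p) : convAA A x ≤ #A :=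
  card_filter_le _ _

theorem pow_card_eq_one_of_mul_mem_s5 {K : Type*} [Field K] {Γ : Finset K} (h0 : (0 : K) ∉ Γ)
    (hmul : ∀ x ∈ Γ, ∀ y ∈ Γ, x * y ∈ Γ) (hinv : ∀ x ∈ Γ, x⁻¹ ∈ Γ) {a : K} (ha : a ∈ Γ) :
    a ^ #Γ = 1 := by
  have ha0 : a ≠ 0 := fun h => h0 (h ▸ ha)
  have h1 : ∏ x ∈ Γ, a * x = ∏ x ∈ Γ, x :=
    Finset.prod_nbij' (a * ·) (a⁻¹ * ·) (fun x hx => hmul a ha x hx)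
      (fun x hx => hmul _ (hinv a ha) x hx) (fun x _ => inv_mul_cancel_left₀ ha0 x)
      (fun x _ => mul_inv_cancel_left₀ ha0 x) fun _ _ => rfl
  rw [Finset.prod_mul_distrib, Finset.prod_const] at h1
  exact mul_eq_right₀ (Finset.prod_ne_zero_iff.2 fun x hx h => h0 (h ▸ hx)) |>.1 h1

theorem energy3_le_card_pow_four {p : ℕ} [NeZero p] (A : Finset (ZMod p)) : energy3 A ≤ #A ^ 4 := by
  calc energy3 A ≤ ∑ x, #A ^ 2 * convAA A x := by
        refine Finset.sum_le_sum fun x _ => ?_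
        rw [pow_succ]
        exact Nat.mul_le_mul_right _ (Nat.pow_le_pow_left (convAA_le_card A x) 2)
    _ = #A ^ 4 := by rw [← Finset.mul_sum, sum_convAA]; ring

theorem pow_three_le_sum_three_mul_sq (k : ℕ) : k ^ 3 ≤ ∑ A ∈ Icc 1 k, 3 * A ^ 2 := by
  induction k with
  | zero => simp
  | succ k ih =>
    rw [Finset.sum_Icc_succ_top (by omega)]
    have h : (k + 1) ^ 3 ≤ k ^ 3 + 3 * (k + 1) ^ 2 := by nlinarith [Nat.zero_le k]
    exact h.trans (Nat.add_le_add_right ih _)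

theorem pow_three_le_sum_levels {r t : ℕ} (hr : r ≤ t) :
    r ^ 3 ≤ 8 * 257 ^ 3 * (∑ A ∈ Icc 1 t, if 257 * A ≤ r then 3 * A ^ 2 else 0) + 257 ^ 2 * r := by
  have h1 : (r / 257) ^ 3 ≤ ∑ A ∈ Icc 1 t, if 257 * A ≤ r then 3 * A ^ 2 else 0 := by
    rw [← Finset.sum_filter]
    refine (pow_three_le_sum_three_mul_sq _).trans
      (Finset.sum_le_sum_of_subset fun A hA => ?_)
    simp only [mem_Icc, mem_filter] at hA ⊢
    omega
  refine le_trans ?_ (Nat.add_le_add_right (Nat.mul_le_mul_left _ h1) _)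
  have h2 := Nat.lt_mul_div_succ r (show 0 < 257 by omega)
  rcases Nat.eq_zero_or_pos (r / 257) with h0 | h0
  · rw [h0] at h2 ⊢
    have : r ^ 2 ≤ 257 ^ 2 := Nat.pow_le_pow_left (by omega) 2
    nlinarith
  · have h3 : r ≤ 2 * 257 * (r / 257) := by omega
    calc r ^ 3 ≤ (2 * 257 * (r / 257)) ^ 3 := Nat.pow_le_pow_left h3 3
      _ = 8 * 257 ^ 3 * (r / 257) ^ 3 := by ring
      _ ≤ _ := Nat.le_add_right _ _

variable {p : ℕ} [Fact p.Prime]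

theorem mul_card_mul_le_of_le_convAA {Γ : Finset (ZMod p)} (hpow : ∀ a ∈ Γ, a ^ #Γ = 1)
    (hΓ : 0 < #Γ) (Λ : Finset (ZMod p)) {m A B : ℕ}
    (hm : ∀ l ∈ Λ, ∃ x, x ≠ 0 ∧ x⁻¹ ^ #Γ = l ∧ m ≤ convAA Γ x)
    (hA : 0 < A) (hΛ : 2 * #Λ * A < B ^ 2) (hAB : A * B ≤ #Γ) (hB : #Γ * B ≤ p) :
    A * (#Λ * m) ≤ 2 * #Γ * B := by
  set S : Finset (ZMod p) := univ.filter fun y => y ^ #Γ ∈ Λ ∧ (y - 1) ^ #Γ = y ^ #Γ with hS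
  have hcard : #Λ * m ≤ #S := by
    rw [Finset.card_eq_sum_card_fiberwise (s := S) (f := fun y => y ^ #Γ) (t := Λ)
      (fun y hy => (mem_filter.1 hy).2.1), ← smul_eq_mul]
    refine Finset.card_nsmul_le_sum _ _ _ fun l hl => ?_
    obtain ⟨x, hx0, hxl, hmx⟩ := hm l hl
    refine hmx.trans (Finset.card_le_card_of_injOn (fun a => (a + x) * x⁻¹) ?_ ?_)
    · intro a ha
      obtain ⟨ha, hax⟩ := mem_filter.1 ha
      have h1 : ((a + x) * x⁻¹) ^ #Γ = l := by rw [mul_pow, hpow _ hax, hxl, one_mul]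
      have h2 : ((a + x) * x⁻¹ - 1) ^ #Γ = l := by
        rw [show (a + x) * x⁻¹ - 1 = a * x⁻¹ by field_simp; ring, mul_pow, hpow _ ha, hxl, one_mul]
      simp [hS, h1, h2, hl]
    · intro a _ b _ hab
      simpa [hx0] using hab
  calc A * (#Λ * m) ≤ A * #S := Nat.mul_le_mul_left A hcard
    _ ≤ 2 * #Γ * B := mul_card_le_of_forall_pow_eq (p := p) Λ S hA hΓ hΛ hAB hB
        fun y hy => (mem_filter.1 hy).2

/-- There are no `j` cosets on which `Γ ∘ Γ ≥ 257 A` when `j A ^ 3` is comparable to `|Γ| ^ 2`. -/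
theorem not_forall_exists_le_convAA {Γ : Finset (ZMod p)} (hpow : ∀ a ∈ Γ, a ^ #Γ = 1)
    (hΓ : 0 < #Γ) (Λ : Finset (ZMod p)) {A : ℕ} (hA : 0 < A) (hAΓ : A ≤ #Γ) (hΛ : 0 < #Λ)
    (hlt : 8 * #Λ * A ^ 3 < #Γ ^ 2) (hle : #Γ ^ 2 ≤ 128 * #Λ * A ^ 3) (hp : #Γ ^ 2 ≤ p * A) :
    ¬ ∀ l ∈ Λ, ∃ x, x ≠ 0 ∧ x⁻¹ ^ #Γ = l ∧ 257 * A ≤ convAA Γ x := by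
  intro hm
  have hAB : A * (#Γ / A) ≤ #Γ := Nat.mul_div_le _ _
  have hAB2 : #Γ ≤ 2 * (A * (#Γ / A)) := by
    have h1 := Nat.lt_mul_div_succ #Γ hA
    have h2 : 0 < #Γ / A := Nat.div_pos hAΓ hA
    nlinarith
  generalize #Γ / A = B at hAB hAB2
  have h1 : 2 * #Λ * A < B ^ 2 := by
    have : #Γ ^ 2 ≤ (2 * (A * B)) ^ 2 := Nat.pow_le_pow_left hAB2 2
    refine Nat.lt_of_mul_lt_mul_left (a := 4 * A ^ 2) ?_
    nlinarith
  have h2 : #Γ * B ≤ p := by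
    refine Nat.le_of_mul_le_mul_left (c := A) ?_ hA
    nlinarith
  have h3 := mul_card_mul_le_of_le_convAA hpow hΓ Λ hm hA h1 hAB h2
  have h4 : 257 * #Λ * A ^ 3 ≤ 2 * #Γ ^ 2 := by
    calc 257 * #Λ * A ^ 3 = A * (A * (#Λ * (257 * A))) := by ring
      _ ≤ A * (2 * #Γ * B) := Nat.mul_le_mul_left A h3
      _ = 2 * #Γ * (A * B) := by ring
      _ ≤ 2 * #Γ * #Γ := Nat.mul_le_mul_left _ hAB
      _ = 2 * #Γ ^ 2 := by ring
  have h5 : 0 < #Λ * A ^ 3 := by positivity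
  nlinarith

theorem pow_three_mul_card_le {Γ : Finset (ZMod p)} (hpow : ∀ a ∈ Γ, a ^ #Γ = 1)
    (hΓ : 2 ^ 14 ≤ #Γ) (hp : #Γ ^ 3 ≤ p ^ 2) {A : ℕ} (hA : 0 < A) :
    A ^ 3 * #{x : ZMod p | x ≠ 0 ∧ 257 * A ≤ convAA Γ x} ≤ #Γ ^ 3 := by
  set N : Finset (ZMod p) := {x : ZMod p | x ≠ 0 ∧ 257 * A ≤ convAA Γ x} with hN
  have hp0 : 0 < p := (Fact.out : p.Prime).pos
  have hΓ0 : 0 < #Γ := by omega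
  rcases N.eq_empty_or_nonempty with hemp | ⟨x₀, hx₀⟩
  · simp [hemp]
  rcases lt_or_ge (p * A) (#Γ ^ 2) with hsmall | hlarge
  · have h1 : A * #N ≤ #Γ ^ 2 := by
      calc A * #N ≤ #N * (257 * A) := by nlinarith [Nat.zero_le (A * #N)]
        _ ≤ ∑ x ∈ N, convAA Γ x := by
            rw [← smul_eq_mul]
            exact Finset.card_nsmul_le_sum _ _ _ fun x hx => (mem_filter.1 hx).2.2
        _ ≤ ∑ x, convAA Γ x := Finset.sum_le_univ_sum_of_nonneg fun _ => Nat.zero_le _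
        _ = #Γ ^ 2 := sum_convAA Γ
    refine Nat.le_of_mul_le_mul_left (c := p ^ 2) ?_ (by positivity)
    calc p ^ 2 * (A ^ 3 * #N) = (p * A) ^ 2 * (A * #N) := by ring
      _ ≤ (#Γ ^ 2) ^ 2 * #Γ ^ 2 := Nat.mul_le_mul (Nat.pow_le_pow_left hsmall.le 2) h1
      _ = #Γ ^ 3 * #Γ ^ 3 := by ring
      _ ≤ p ^ 2 * #Γ ^ 3 := Nat.mul_le_mul_right _ hp
  have hAΓ : A ≤ #Γ := by
    have h1 := (mem_filter.1 hx₀).2.2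
    have h2 := convAA_le_card Γ x₀
    omega
  rcases lt_or_ge (16 * A ^ 3) (#Γ ^ 2) with hlt | hge
  · set L := N.image fun x => x⁻¹ ^ #Γ with hL
    have hNL : #N ≤ #Γ * #L := by
      refine Finset.card_le_mul_card_image N _ fun l _ => ?_
      calc #{x ∈ N | x⁻¹ ^ #Γ = l} ≤ #(Polynomial.nthRoots #Γ l⁻¹).toFinset := by
            refine Finset.card_le_card fun x hx => ?_
            rw [Multiset.mem_toFinset, Polynomial.mem_nthRoots hΓ0, ← (mem_filter.1 hx).2,
              inv_pow, inv_inv]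
        _ ≤ (Polynomial.nthRoots #Γ l⁻¹).card := Multiset.toFinset_card_le _
        _ ≤ #Γ := Polynomial.card_nthRoots _ _
    have hLt : 8 * #L * A ^ 3 < #Γ ^ 2 := by
      by_contra! hcon
      have hd1 := Nat.div_mul_le_self (#Γ ^ 2) (16 * A ^ 3)
      have hd2 := Nat.lt_div_mul_add (a := #Γ ^ 2) (b := 16 * A ^ 3) (by positivity)
      generalize #Γ ^ 2 / (16 * A ^ 3) = j at hd1 hd2
      have h1 : 8 * (j + 1) * A ^ 3 < #Γ ^ 2 := by nlinarith
      have h2 : j + 1 ≤ #L := by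
        refine (Nat.lt_of_mul_lt_mul_left (a := 8 * A ^ 3) ?_).le
        nlinarith
      obtain ⟨Λ, hΛL, hΛ⟩ := Finset.exists_subset_card_eq h2
      refine not_forall_exists_le_convAA hpow hΓ0 Λ hA hAΓ (by omega) (by rwa [hΛ])
        (by rw [hΛ]; nlinarith) hlarge fun l hl => ?_
      obtain ⟨x, hx, hxl⟩ := mem_image.1 (hΛL hl)
      obtain ⟨hx0, hxA⟩ := (mem_filter.1 hx).2
      exact ⟨x, hx0, hxl, hxA⟩
    nlinarith [Nat.mul_le_mul_left (A ^ 3) hNL, Nat.mul_le_mul_left #Γ hLt.le]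
  · exfalso
    have hex : ∃ n, #Γ ^ 2 ≤ 16 * n ^ 3 := ⟨A, hge⟩
    obtain ⟨A₀, hA₀⟩ : ∃ k, Nat.find hex = k + 1 := by
      refine Nat.exists_eq_succ_of_ne_zero fun h => ?_
      have := Nat.find_spec hex
      rw [h] at this
      nlinarith
    have h1 : #Γ ^ 2 ≤ 16 * (A₀ + 1) ^ 3 := hA₀ ▸ Nat.find_spec hex
    have h2 : 16 * A₀ ^ 3 < #Γ ^ 2 := not_le.1 (Nat.find_min hex (by omega))
    have h3 : A₀ + 1 ≤ A := hA₀ ▸ Nat.find_min' hex hge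
    have hA₀0 : 0 < A₀ := by
      refine Nat.pos_of_ne_zero fun h => ?_
      rw [h] at h1
      nlinarith
    have h4 : #Γ ^ 2 ≤ 128 * A₀ ^ 3 := by
      have : (A₀ + 1) ^ 3 ≤ (2 * A₀) ^ 3 := Nat.pow_le_pow_left (by omega) 3
      nlinarith
    have h5 : 128 * #Γ ^ 4 ≤ p ^ 3 := by
      refine (Nat.pow_le_pow_iff_left (n := 2) (by omega)).1 ?_
      calc (128 * #Γ ^ 4) ^ 2 = 2 ^ 14 * #Γ ^ 8 := by ring
        _ ≤ #Γ * #Γ ^ 8 := Nat.mul_le_mul_right _ hΓ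
        _ = (#Γ ^ 3) ^ 3 := by ring
        _ ≤ (p ^ 2) ^ 3 := Nat.pow_le_pow_left hp 3
        _ = (p ^ 3) ^ 2 := by ring
    have h6 : #Γ ^ 2 ≤ p * A₀ := by
      refine (Nat.pow_le_pow_iff_left (n := 3) (by omega)).1 ?_
      refine Nat.le_of_mul_le_mul_left (c := 128) ?_ (by omega)
      calc 128 * (#Γ ^ 2) ^ 3 = 128 * #Γ ^ 4 * #Γ ^ 2 := by ring
        _ ≤ p ^ 3 * (128 * A₀ ^ 3) := Nat.mul_le_mul h5 h4
        _ = 128 * (p * A₀) ^ 3 := by ring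
    refine not_forall_exists_le_convAA hpow hΓ0 {x₀⁻¹ ^ #Γ} hA₀0 (by omega) (by simp)
      (by rw [card_singleton]; omega) (by rw [card_singleton]; omega) h6 fun l hl => ?_
    obtain ⟨hx0, hxA⟩ := (mem_filter.1 hx₀).2
    exact ⟨x₀, hx0, (mem_singleton.1 hl).symm, by omega⟩

theorem energy3_le_sum_levels (Γ : Finset (ZMod p)) :
    energy3 Γ ≤ #Γ ^ 3 + 8 * 257 ^ 3 * (∑ A ∈ Icc 1 #Γ,
      3 * A ^ 2 * #{x : ZMod p | x ≠ 0 ∧ 257 * A ≤ convAA Γ x}) + 257 ^ 2 * #Γ ^ 2 := by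
  have h1 : ∑ x ∈ univ.erase (0 : ZMod p), convAA Γ x ^ 3 ≤
      ∑ x ∈ univ.erase (0 : ZMod p), (8 * 257 ^ 3 * (∑ A ∈ Icc 1 #Γ,
        if 257 * A ≤ convAA Γ x then 3 * A ^ 2 else 0) + 257 ^ 2 * convAA Γ x) :=
    Finset.sum_le_sum fun x _ => pow_three_le_sum_levels (convAA_le_card Γ x)
  have h2 : ∑ x ∈ univ.erase (0 : ZMod p), convAA Γ x ≤ #Γ ^ 2 :=
    (Finset.sum_le_univ_sum_of_nonneg fun _ => Nat.zero_le _).trans (sum_convAA Γ).le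
  have h3 (A : ℕ) : ∑ x ∈ univ.erase (0 : ZMod p),
      (if 257 * A ≤ convAA Γ x then 3 * A ^ 2 else 0) =
        3 * A ^ 2 * #{x : ZMod p | x ≠ 0 ∧ 257 * A ≤ convAA Γ x} := by
    rw [← Finset.sum_filter, Finset.sum_const, smul_eq_mul, mul_comm]
    congr 2
    ext x
    simp
  rw [Finset.sum_add_distrib, ← Finset.mul_sum, ← Finset.mul_sum, Finset.sum_comm] at h1
  simp_rw [h3] at h1
  have h4 : convAA Γ 0 ^ 3 ≤ #Γ ^ 3 := Nat.pow_le_pow_left (convAA_le_card Γ 0) 3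
  rw [energy3, ← Finset.add_sum_erase _ _ (mem_univ (0 : ZMod p))]
  omega

theorem energy3_le_of_pow_card_eq_one {Γ : Finset (ZMod p)} (hpow : ∀ a ∈ Γ, a ^ #Γ = 1)
    (hΓ : 2 ^ 14 ≤ #Γ) (hp : #Γ ^ 3 ≤ p ^ 2) :
    (energy3 Γ : ℝ) ≤ (#Γ : ℝ) ^ 3 + 24 * 257 ^ 3 * (#Γ : ℝ) ^ 3 * (1 + Real.log #Γ) +
      257 ^ 2 * (#Γ : ℝ) ^ 2 := by
  have h1 : (energy3 Γ : ℝ) ≤ (#Γ : ℝ) ^ 3 + 8 * 257 ^ 3 * (∑ A ∈ Icc 1 #Γ,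
      3 * (A : ℝ) ^ 2 * (#{x : ZMod p | x ≠ 0 ∧ 257 * A ≤ convAA Γ x} : ℝ)) +
      257 ^ 2 * (#Γ : ℝ) ^ 2 := by
    exact_mod_cast energy3_le_sum_levels Γ
  have h2 : ∑ A ∈ Icc 1 #Γ,
      3 * (A : ℝ) ^ 2 * (#{x : ZMod p | x ≠ 0 ∧ 257 * A ≤ convAA Γ x} : ℝ) ≤
      3 * (#Γ : ℝ) ^ 3 * (1 + Real.log #Γ) := by
    calc _ ≤ ∑ A ∈ Icc 1 #Γ, 3 * (#Γ : ℝ) ^ 3 * (A : ℝ)⁻¹ := by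
          refine Finset.sum_le_sum fun A hA => ?_
          have hA0 : 0 < A := (mem_Icc.1 hA).1
          have h : (A : ℝ) ^ 3 * (#{x : ZMod p | x ≠ 0 ∧ 257 * A ≤ convAA Γ x} : ℝ) ≤
              (#Γ : ℝ) ^ 3 := by
            exact_mod_cast pow_three_mul_card_le hpow hΓ hp hA0
          have hA0' : (0 : ℝ) < A := by exact_mod_cast hA0
          rw [← div_eq_mul_inv, le_div_iff₀ hA0']
          nlinarith
      _ = 3 * (#Γ : ℝ) ^ 3 * (harmonic #Γ : ℝ) := by
          rw [← Finset.mul_sum, harmonic_eq_sum_Icc]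
          push_cast
          rfl
      _ ≤ _ := by
          gcongr
          exact harmonic_le_one_add_log _
  linarith

end Energy

/-- There is an absolute constant `C > 0` such that for every prime `p` and
every multiplicative subgroup `Γ ⊆ F_p^*` with `2 ≤ |Γ| ≤ p^{2/3}`, one has
`E₃(Γ) ≤ C · |Γ|³ · log |Γ|`. -/
theorem stmt5 :
    ∃ C : ℝ, 0 < C ∧
      ∀ (p : ℕ) [Fact p.Prime], ∀ Γ : Finset (ZMod p),
        (0 : ZMod p) ∉ Γ → (1 : ZMod p) ∈ Γ →
        (∀ x ∈ Γ, ∀ y ∈ Γ, x * y ∈ Γ) → (∀ x ∈ Γ, x⁻¹ ∈ Γ) →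
        2 ≤ Γ.card → (Γ.card : ℝ) ≤ (p : ℝ) ^ ((2 : ℝ) / 3) →
        (energy3 Γ : ℝ) ≤ C * (Γ.card : ℝ) ^ (3 : ℕ) * Real.log Γ.card := by
  refine ⟨73 * 257 ^ 3, by norm_num, fun p _ Γ h0 h1 hmul hinv h2 hp => ?_⟩
  have hpow : ∀ a ∈ Γ, a ^ #Γ = 1 := fun a ha => pow_card_eq_one_of_mul_mem_s5 h0 hmul hinv ha
  have hp' : #Γ ^ 3 ≤ p ^ 2 := by
    have h : (#Γ : ℝ) ^ 3 ≤ ((p : ℝ) ^ ((2 : ℝ) / 3)) ^ 3 := by gcongr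
    rw [← Real.rpow_mul_natCast (Nat.cast_nonneg p)] at h
    norm_num at h
    exact_mod_cast h
  have ht2 : (2 : ℝ) ≤ #Γ := by exact_mod_cast h2
  have hlog : (1 : ℝ) / 2 ≤ Real.log #Γ := by
    have := Real.log_le_log (by norm_num) ht2
    have := Real.log_two_gt_d9
    linarith
  have ht3 : (0 : ℝ) < (#Γ : ℝ) ^ 3 := by positivity
  have hmain : (#Γ : ℝ) ^ 3 * (1 / 2) ≤ (#Γ : ℝ) ^ 3 * Real.log #Γ := by gcongr
  rcases lt_or_ge #Γ (2 ^ 14) with hlt | hge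
  · have hE : (energy3 Γ : ℝ) ≤ (#Γ : ℝ) ^ 4 := by exact_mod_cast energy3_le_card_pow_four Γ
    have hlt' : (#Γ : ℝ) ≤ 2 ^ 14 := by exact_mod_cast hlt.le
    have h4 : (#Γ : ℝ) ^ 4 ≤ 2 ^ 14 * (#Γ : ℝ) ^ 3 := by
      rw [pow_succ' _ 3]
      gcongr
    linarith
  · have hE := energy3_le_of_pow_card_eq_one hpow hge hp'
    have h23 : (#Γ : ℝ) ^ 2 ≤ (#Γ : ℝ) ^ 3 := pow_le_pow_right₀ (by linarith) (by omega)
    linarith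
end
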